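/- Let ψ : ℝ^n∖{0} → ℝ^n∖{0} be a smooth bijection with smooth inverse ψ^{-1}, with both ψ and ψ^{-1} positively homogeneous of degree 1 (ψ(λξ) = λψ(ξ) and ψ^{-1}(λξ) = λψ^{-1}(ξ) for all λ > 0, ξ ≠ 0), and assume |det Dψ(ξ)| ≥ C₀ > 0 for all ξ ≠ 0. Let m ∈ ℤ with |m| < n/2. Then the operators T_ψ u := F^{-1}[(Fu)∘ψ] and T_ψ^{-1} u := F^{-1}[(Fu)∘ψ^{-1}], defined for Schwartz u, satisfy ‖⟨x⟩^m T_ψ u‖_{L²(ℝ^n)} ≤ C ‖⟨x⟩^m u‖_{L²(ℝ^n)} and ‖⟨x⟩^m T_ψ^{-1} u‖_{L²(ℝ^n)} ≤ C ‖⟨x⟩^m u‖_{L²(ℝ^n)} for some C independent of u; that is, T_ψ and T_ψ^{-1} are bounded on the weighted space L²_m(ℝ^n). -/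

import Mathlib

open MeasureTheory Complex SchwartzMap
open scoped BigOperators ENNReal Real RealInnerProductSpace

noncomputable section

/-- The Fourier transform `F u(ξ) = ∫ e^{-i x·ξ} u(x) dx` (for integrable `u`). -/
def FTint {n : ℕ} (u : EuclideanSpace ℝ (Fin n) → ℂ) (ξ : EuclideanSpace ℝ (Fin n)) : ℂ :=
  ∫ x, Complex.exp (-(Complex.I * (⟪x, ξ⟫ : ℝ))) * u x

/-- The inverse Fourier transform
`F⁻¹ v(x) = (2π)^{-n} ∫ e^{i x·ξ} v(ξ) dξ` (for integrable `v`). -/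
def FTinvInt {n : ℕ} (v : EuclideanSpace ℝ (Fin n) → ℂ) (x : EuclideanSpace ℝ (Fin n)) : ℂ :=
  (((2 * Real.pi) ^ n : ℝ) : ℂ)⁻¹ * ∫ ξ, Complex.exp (Complex.I * (⟪x, ξ⟫ : ℝ)) * v ξ

/-- The Japanese bracket `⟨x⟩ = (1+|x|²)^{1/2}`. -/
def jap {n : ℕ} (x : EuclideanSpace ℝ (Fin n)) : ℝ := Real.sqrt (1 + ‖x‖ ^ 2)

/-- The Jacobian matrix `Dψ(ξ)` of a map `ψ : ℝ^n → ℝ^n`. -/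
def jacMat {n : ℕ} (ψ : EuclideanSpace ℝ (Fin n) → EuclideanSpace ℝ (Fin n))
    (ξ : EuclideanSpace ℝ (Fin n)) : Matrix (Fin n) (Fin n) ℝ :=
  Matrix.of fun i j => fderiv ℝ ψ ξ (EuclideanSpace.single j 1) i

namespace PW
variable {E F G : Type*} [NormedAddCommGroup E] [NormedSpace ℝ E]
  [NormedAddCommGroup F] [NormedSpace ℝ F] [NormedAddCommGroup G] [NormedSpace ℝ G]

/-- punctured space -/
abbrev S (E : Type*) [NormedAddCommGroup E] : Set E := {0}ᶜ

lemma isOpenS : IsOpen (S E) := isOpen_compl_singleton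
lemma udS : UniqueDiffOn ℝ (S E) := isOpenS.uniqueDiffOn

/-- scale invariant derivative sums -/
def NN (k : ℕ) (f : E → F) (x : E) : ℝ :=
  ∑ j ∈ Finset.range (k + 1), ‖x‖ ^ j * ‖iteratedFDerivWithin ℝ j f (S E) x‖

lemma NN_nonneg (k : ℕ) (f : E → F) (x : E) : 0 ≤ NN k f x :=
  Finset.sum_nonneg fun _ _ => by positivity

lemma le_NN {k j : ℕ} (hj : j ≤ k) (f : E → F) (x : E) :
    ‖x‖ ^ j * ‖iteratedFDerivWithin ℝ j f (S E) x‖ ≤ NN k f x :=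
  Finset.single_le_sum (f := fun j => ‖x‖ ^ j * ‖iteratedFDerivWithin ℝ j f (S E) x‖)
    (fun _ _ => by positivity) (Finset.mem_range.2 (Nat.lt_succ_of_le hj))

lemma NN_congr {k : ℕ} {f g : E → F} (h : Set.EqOn f g (S E)) {x : E} (hx : x ∈ S E) :
    NN k f x = NN k g x := by
  unfold NN
  refine Finset.sum_congr rfl fun j _ => ?_
  rw [iteratedFDerivWithin_congr h hx]

lemma scale (f : E → F) {a : ℝ} (ha : 0 < a) (i : ℕ) {x : E} (hx : x ∈ S E) :
    ‖iteratedFDerivWithin ℝ i (fun z => f (a • z)) (S E) x‖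
      = a ^ i * ‖iteratedFDerivWithin ℝ i f (S E) (a • x)‖ := by
  have ha' : a ≠ 0 := ha.ne'
  let g : E ≃L[ℝ] E := ContinuousLinearEquiv.smulLeft (Units.mk0 a ha')
  have hg : ∀ z, g z = a • z := fun z => rfl
  have hp : g ⁻¹' (S E) = S E := by
    ext z; simp [hg, ha']
  have h := g.iteratedFDerivWithin_comp_right f (udS (E := E)) (x := x)
    (by simpa [hg, ha'] using hx) i
  rw [hp] at h
  have h2 : (f ∘ g) = fun z => f (a • z) := rfl
  rw [h2] at h
  rw [h]
  have h3 : ((iteratedFDerivWithin ℝ i f (S E) (g x)).compContinuousLinearMap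
      fun _ => (g : E →L[ℝ] E)) = a ^ i • iteratedFDerivWithin ℝ i f (S E) (a • x) := by
    ext m
    simp only [ContinuousMultilinearMap.compContinuousLinearMap_apply,
      _root_.smul_apply, ContinuousLinearEquiv.coe_coe, hg]
    rw [ContinuousMultilinearMap.map_smul_univ]
    simp
  rw [h3, norm_smul, norm_pow, Real.norm_of_nonneg ha.le]

lemma NN_scale (k : ℕ) (f : E → F) {a : ℝ} (ha : 0 < a) {x : E} (hx : x ∈ S E) :
    NN k (fun z => f (a • z)) x = NN k f (a • x) := by
  unfold NN
  refine Finset.sum_congr rfl fun j _ => ?_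
  rw [scale f ha j hx, norm_smul, mul_pow, Real.norm_of_nonneg ha.le]
  ring

lemma NN_const_smul (k : ℕ) (f : E → F) (hf : ContDiffOn ℝ (⊤ : ℕ∞) f (S E)) (a : ℝ) {x : E}
    (hx : x ∈ S E) : NN k (fun z => a • f z) x = |a| * NN k f x := by
  unfold NN
  rw [Finset.mul_sum]
  refine Finset.sum_congr rfl fun j _ => ?_
  have : (fun z => a • f z) = a • f := rfl
  rw [this, iteratedFDerivWithin_const_smul_apply ((hf x hx).of_le (mod_cast le_top)) udS hx,
    norm_smul, Real.norm_eq_abs]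
  ring

lemma NN_continuousOn (k : ℕ) (f : E → F) (hf : ContDiffOn ℝ (⊤ : ℕ∞) f (S E)) :
    ContinuousOn (NN k f) (S E) := by
  unfold NN
  refine continuousOn_finsetSum _ fun j _ => ?_
  refine ContinuousOn.mul (by fun_prop) ?_
  exact (hf.continuousOn_iteratedFDerivWithin (mod_cast le_top) udS).norm

lemma NN_homog [FiniteDimensional ℝ E] (k d : ℕ) (f : E → F)
    (hf : ContDiffOn ℝ (⊤ : ℕ∞) f (S E))
    (hh : ∀ a : ℝ, 0 < a → ∀ x ∈ S E, f (a • x) = a ^ d • f x) :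
    ∃ C : ℝ, 1 ≤ C ∧ ∀ x ∈ S E, NN k f x ≤ C * ‖x‖ ^ d := by
  have : ProperSpace E := FiniteDimensional.proper ℝ E
  obtain ⟨C, hC⟩ := (isCompact_sphere (0 : E) 1).exists_bound_of_continuousOn
    ((NN_continuousOn k f hf).mono (by
      intro x hx; simp at hx ⊢; rintro rfl; simp at hx))
  refine ⟨max 1 C, le_max_left _ _, fun x hx => ?_⟩
  have hx0 : x ≠ 0 := hx
  have hn : 0 < ‖x‖ := norm_pos_iff.2 hx0
  set w := ‖x‖⁻¹ • x with hw
  have hwS : w ∈ S E := by simp [hw, hx0]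
  have hwn : ‖w‖ = 1 := by simp [hw, norm_smul, hn.ne']
  have hxw : x = ‖x‖ • w := by simp [hw, smul_smul, hn.ne']
  have h1 : NN k f x = ‖x‖ ^ d * NN k f w := by
    conv_lhs => rw [hxw]
    rw [← NN_scale k f hn hwS, NN_congr (g := fun z => ‖x‖ ^ d • f z) (fun z hz => hh _ hn z hz) hwS,
      NN_const_smul k f hf _ hwS, abs_of_nonneg (by positivity)]
  have h2 := hC w (by simp [hwn])
  rw [h1, mul_comm]
  gcongr
  exact (le_abs_self _).trans (h2.trans (le_max_right _ _))

lemma NN_mul (k : ℕ) (b : E → ℂ) (f : E → ℂ) (hb : ContDiffOn ℝ (⊤ : ℕ∞) b (S E))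
    (hf : ContDiffOn ℝ (⊤ : ℕ∞) f (S E)) {x : E} (hx : x ∈ S E) :
    NN k (fun z => b z * f z) x ≤ (2 : ℝ) ^ (2 * k + 1) * (NN k b x * NN k f x) := by
  have key : ∀ j ∈ Finset.range (k + 1),
      ‖x‖ ^ j * ‖iteratedFDerivWithin ℝ j (fun z => b z * f z) (S E) x‖ ≤
        2 ^ k * (NN k b x * NN k f x) := by
    intro j hj
    have hj' : j ≤ k := Nat.lt_succ_iff.1 (Finset.mem_range.1 hj)
    have := norm_iteratedFDerivWithin_mul_le hb hf udS hx (n := j) (mod_cast le_top)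
    calc _ ≤ ‖x‖ ^ j * ∑ i ∈ Finset.range (j + 1), (j.choose i : ℝ) *
            ‖iteratedFDerivWithin ℝ i b (S E) x‖ * ‖iteratedFDerivWithin ℝ (j - i) f (S E) x‖ := by
          gcongr
      _ = ∑ i ∈ Finset.range (j + 1), (j.choose i : ℝ) *
            ((‖x‖ ^ i * ‖iteratedFDerivWithin ℝ i b (S E) x‖) *
             (‖x‖ ^ (j - i) * ‖iteratedFDerivWithin ℝ (j - i) f (S E) x‖)) := by
          rw [Finset.mul_sum]
          refine Finset.sum_congr rfl fun i hi => ?_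
          have hi' : i ≤ j := Nat.lt_succ_iff.1 (Finset.mem_range.1 hi)
          have : ‖x‖ ^ j = ‖x‖ ^ i * ‖x‖ ^ (j - i) := by rw [← pow_add, Nat.add_sub_cancel' hi']
          rw [this]; ring
      _ ≤ ∑ i ∈ Finset.range (j + 1), (j.choose i : ℝ) * (NN k b x * NN k f x) := by
          refine Finset.sum_le_sum fun i hi => ?_
          have hi' : i ≤ j := Nat.lt_succ_iff.1 (Finset.mem_range.1 hi)
          gcongr
          · exact NN_nonneg _ _ _
          · exact le_NN (hi'.trans hj') _ _
          · exact le_NN ((Nat.sub_le _ _).trans hj') _ _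
      _ = 2 ^ j * (NN k b x * NN k f x) := by
          rw [← Finset.sum_mul]
          congr 1
          exact_mod_cast Nat.sum_range_choose j
      _ ≤ _ := by
          have := mul_nonneg (NN_nonneg k b x) (NN_nonneg k f x)
          gcongr
          norm_num
  have h0 := mul_nonneg (NN_nonneg k b x) (NN_nonneg k f x)
  calc NN k (fun z => b z * f z) x ≤ ∑ j ∈ Finset.range (k + 1), 2 ^ k * (NN k b x * NN k f x) :=
        Finset.sum_le_sum key
    _ = (k + 1 : ℝ) * 2 ^ k * (NN k b x * NN k f x) := by
        rw [Finset.sum_const, Finset.card_range, nsmul_eq_mul]; push_cast; ring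
    _ ≤ _ := by
        gcongr
        have : (k + 1 : ℝ) ≤ 2 ^ (k + 1) := by exact_mod_cast (Nat.lt_two_pow_self (n := k + 1)).le
        calc (k + 1 : ℝ) * 2 ^ k ≤ 2 ^ (k + 1) * 2 ^ k := by gcongr
          _ = _ := by rw [← pow_add]; congr 1; ring

lemma NN_comp [FiniteDimensional ℝ E] (k : ℕ) (ψ : E → E) (hψ : ContDiffOn ℝ (⊤ : ℕ∞) ψ (S E))
    (hψ0 : ∀ x ∈ S E, ψ x ∈ S E)
    (hh : ∀ a : ℝ, 0 < a → ∀ x ∈ S E, ψ (a • x) = a • ψ x)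
    (c : ℝ) (hc : ∀ x ∈ S E, ‖x‖ ≤ c * ‖ψ x‖) :
    ∃ C : ℝ, 0 ≤ C ∧ ∀ f : E → F, ContDiffOn ℝ (⊤ : ℕ∞) f (S E) → ∀ x ∈ S E,
      NN k (fun z => f (ψ z)) x ≤ C * NN k f (ψ x) := by
  obtain ⟨C, hC1, hC⟩ := NN_homog k 1 ψ hψ (by simpa using hh)
  set c' := max 1 c with hc'
  have hc'1 : 1 ≤ c' := le_max_left _ _
  refine ⟨∑ j ∈ Finset.range (k + 1), (j.factorial : ℝ) * c' ^ k * C ^ j, by positivity,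
    fun f hf x hx => ?_⟩
  have hx0 : x ≠ 0 := hx
  have hn : 0 < ‖x‖ := norm_pos_iff.2 hx0
  have hni : 0 < ‖x‖⁻¹ := by positivity
  set g : E → F := fun y => f (‖x‖ • y)
  set φ : E → E := fun z => ‖x‖⁻¹ • ψ z
  have hgφ : (fun z => f (ψ z)) = g ∘ φ := by
    ext z; simp [g, φ, smul_smul, hn.ne']
  have hg : ContDiffOn ℝ (⊤ : ℕ∞) g (S E) := by
    refine hf.comp (contDiff_const_smul ‖x‖).contDiffOn ?_
    intro z hz
    simpa [hx0] using hz
  have hφ : ContDiffOn ℝ (⊤ : ℕ∞) φ (S E) := hψ.const_smul _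
  have hmaps : Set.MapsTo φ (S E) (S E) := by
    intro z hz
    have := hψ0 z hz
    simpa [φ, hx0] using this
  unfold NN
  rw [Finset.sum_mul]
  refine Finset.sum_le_sum fun j hj => ?_
  have hj' : j ≤ k := Nat.lt_succ_iff.1 (Finset.mem_range.1 hj)
  have hN := NN_nonneg k f (ψ x)
  have hb := norm_iteratedFDerivWithin_comp_le hg hφ (n := j) (mod_cast le_top) udS udS hmaps hx
    (C := c' ^ k * NN k f (ψ x)) (D := C * ‖x‖⁻¹) (by
      intro i hi
      rw [scale f hn i (hmaps hx)]
      have e : ‖x‖ • φ x = ψ x := by simp [φ, smul_smul, hn.ne']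
      rw [e]
      calc ‖x‖ ^ i * ‖iteratedFDerivWithin ℝ i f (S E) (ψ x)‖
          ≤ (c' * ‖ψ x‖) ^ i * ‖iteratedFDerivWithin ℝ i f (S E) (ψ x)‖ := by
            gcongr
            exact (hc x hx).trans (by gcongr; exact le_max_right _ _)
        _ = c' ^ i * (‖ψ x‖ ^ i * ‖iteratedFDerivWithin ℝ i f (S E) (ψ x)‖) := by ring
        _ ≤ c' ^ k * NN k f (ψ x) := by
            gcongr
            · exact hi.trans hj'
            · exact le_NN (hi.trans hj') _ _) (by
      intro i hi1 hi
      have h1 : ‖x‖ ^ i * ‖iteratedFDerivWithin ℝ i ψ (S E) x‖ ≤ C * ‖x‖ := by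
        have := (le_NN (hi.trans hj') ψ x).trans (hC x hx)
        simpa using this
      have h2 : iteratedFDerivWithin ℝ i φ (S E) x = ‖x‖⁻¹ • iteratedFDerivWithin ℝ i ψ (S E) x :=
        iteratedFDerivWithin_const_smul_apply ((hψ x hx).of_le (mod_cast le_top)) udS hx
      rw [h2, norm_smul, Real.norm_of_nonneg hni.le, mul_pow, inv_pow]
      rw [← div_eq_mul_inv, le_div_iff₀ (by positivity)]
      calc ‖x‖⁻¹ * ‖iteratedFDerivWithin ℝ i ψ (S E) x‖ * ‖x‖ ^ i
          = ‖x‖⁻¹ * (‖x‖ ^ i * ‖iteratedFDerivWithin ℝ i ψ (S E) x‖) := by ring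
        _ ≤ ‖x‖⁻¹ * (C * ‖x‖) := by gcongr
        _ = C := by field_simp
        _ ≤ C ^ i := le_self_pow₀ hC1 (by omega))
  rw [hgφ]
  calc _ ≤ ‖x‖ ^ j * (j.factorial * (c' ^ k * NN k f (ψ x)) * (C * ‖x‖⁻¹) ^ j) := by gcongr
    _ = j.factorial * c' ^ k * C ^ j * NN k f (ψ x) := by
      rw [mul_pow, inv_pow]; field_simp

end PW

namespace PW
open Module

lemma cs_lintegral {α : Type*} [MeasurableSpace α] (μ : Measure α) {f g : α → ℝ≥0∞}
    (hf : AEMeasurable f μ) (hg : AEMeasurable g μ) :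
    (∫⁻ a, f a * g a ∂μ) ^ 2 ≤ (∫⁻ a, f a ^ 2 ∂μ) * ∫⁻ a, g a ^ 2 ∂μ := by
  have h := ENNReal.lintegral_mul_le_Lp_mul_Lq μ Real.HolderConjugate.two_two hf hg
  simp only [Pi.mul_apply] at h
  calc _ ≤ ((∫⁻ a, f a ^ (2 : ℝ) ∂μ) ^ (1 / (2 : ℝ)) * (∫⁻ a, g a ^ (2 : ℝ) ∂μ) ^ (1 / (2 : ℝ))) ^ 2 := by
        gcongr
    _ = _ := by
        rw [mul_pow, ← ENNReal.rpow_natCast, ← ENNReal.rpow_natCast, ← ENNReal.rpow_mul,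
          ← ENNReal.rpow_mul]
        norm_num

/-- the constant in the Hardy inequality -/
def hardyA : ℝ≥0∞ := ∫⁻ t in Set.Ioi (1 : ℝ), ENNReal.ofReal (t ^ (-(3 / 4) : ℝ)) ^ 2

lemma hardyA_lt_top : hardyA < ⊤ := by
  have h : IntegrableOn (fun t : ℝ => t ^ (-(3 / 2) : ℝ)) (Set.Ioi 1) :=
    integrableOn_Ioi_rpow_of_lt (by norm_num) one_pos
  have h2 := h.lintegral_lt_top
  refine lt_of_le_of_lt (le_of_eq ?_) h2
  refine setLIntegral_congr_fun measurableSet_Ioi fun t ht => ?_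
  have ht0 : (0 : ℝ) < t := lt_trans one_pos ht
  rw [← ENNReal.ofReal_pow (by positivity), ← Real.rpow_natCast, ← Real.rpow_mul ht0.le]
  norm_num

variable {E F : Type*} [NormedAddCommGroup E] [NormedSpace ℝ E]
  [NormedAddCommGroup F] [NormedSpace ℝ F]

lemma ray_bound (f : E → F) (hf : ContDiff ℝ 1 f)
    (hdec : Filter.Tendsto f (Filter.cocompact E) (nhds 0)) (x : E) (hx : x ≠ 0) :
    ‖f x‖ₑ ≤ ∫⁻ t in Set.Ioi (1 : ℝ), ENNReal.ofReal (‖fderiv ℝ f (t • x)‖ * ‖x‖) := by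
  set I := ∫⁻ t in Set.Ioi (1 : ℝ), ENNReal.ofReal (‖fderiv ℝ f (t • x)‖ * ‖x‖) with hI
  have hγ : ∀ t : ℝ, HasDerivAt (fun t : ℝ => f (t • x)) (fderiv ℝ f (t • x) x) t := by
    intro t
    have h1 : HasFDerivAt f (fderiv ℝ f (t • x)) (t • x) :=
      (hf.differentiable one_ne_zero _).hasFDerivAt
    have h2 : HasDerivAt (fun t : ℝ => t • x) x t := by
      simpa using (hasDerivAt_id t).smul_const x
    exact h1.comp_hasDerivAt t h2
  have hb : ∀ T : ℝ, 1 ≤ T → ‖f x‖ₑ ≤ ‖f (T • x)‖ₑ + I := by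
    intro T hT
    have hc : ContDiffOn ℝ 1 (fun t : ℝ => f (t • x)) (Set.Icc 1 T) :=
      (hf.comp (contDiff_id.smul contDiff_const)).contDiffOn
    have h1 := enorm_sub_le_lintegral_deriv_of_contDiffOn_Icc hc hT
    have h2 : ∫⁻ t in Set.Icc 1 T, ‖deriv (fun t : ℝ => f (t • x)) t‖ₑ ≤ I := by
      rw [← restrict_Ioc_eq_restrict_Icc]
      refine (lintegral_mono_set Set.Ioc_subset_Ioi_self).trans ?_
      refine lintegral_mono fun t => ?_
      rw [(hγ t).deriv, ← ofReal_norm]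
      exact ENNReal.ofReal_le_ofReal (ContinuousLinearMap.le_opNorm _ _)
    have h3 : f x = f (T • x) - (f (T • x) - f ((1 : ℝ) • x)) := by simp
    calc ‖f x‖ₑ = ‖f (T • x) - (f (T • x) - f ((1 : ℝ) • x))‖ₑ := by rw [← h3]
      _ ≤ ‖f (T • x)‖ₑ + ‖f (T • x) - f ((1 : ℝ) • x)‖ₑ := enorm_sub_le
      _ ≤ _ := by gcongr; exact h1.trans h2
  have ht : Filter.Tendsto (fun T : ℝ => ‖f (T • x)‖ₑ + I) Filter.atTop (nhds (0 + I)) := by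
    refine Filter.Tendsto.add ?_ tendsto_const_nhds
    have h4 : Filter.Tendsto (fun T : ℝ => T • x) Filter.atTop (Filter.cocompact E) := by
      refine Filter.Tendsto.mono_right ?_ Metric.cobounded_le_cocompact
      rw [← tendsto_norm_atTop_iff_cobounded]
      simp only [norm_smul]
      exact (Filter.tendsto_abs_atTop_atTop).atTop_mul_const (norm_pos_iff.2 hx)
    have h5 := (hdec.comp h4).enorm
    simpa using h5
  rw [zero_add] at ht
  exact ge_of_tendsto ht (Filter.eventually_atTop.2 ⟨1, hb⟩)

variable [MeasurableSpace E] [BorelSpace E] [FiniteDimensional ℝ E]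

lemma lintegral_smul_arg (μ : Measure E) [μ.IsAddHaarMeasure] (g : E → ℝ≥0∞) (hg : Measurable g)
    {t : ℝ} (ht : 0 < t) :
    ∫⁻ x, g (t • x) ∂μ = ENNReal.ofReal ((t ^ finrank ℝ E)⁻¹) * ∫⁻ x, g x ∂μ := by
  have h := lintegral_map (μ := μ) hg (measurable_const_smul (α := E) t)
  rw [Measure.map_addHaar_smul μ ht.ne', lintegral_smul_measure] at h
  rw [← h, abs_of_nonneg (by positivity)]
  rfl

lemma hardy (μ : Measure E) [μ.IsAddHaarMeasure] (f : E → F) (hf : ContDiff ℝ 1 f)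
    (hdec : Filter.Tendsto f (Filter.cocompact E) (nhds 0)) (p : ℕ) (hp : 2 * (p + 1) < finrank ℝ E) :
    ∫⁻ x, ENNReal.ofReal ((‖x‖ ^ (p + 1))⁻¹ * ‖f x‖) ^ 2 ∂μ ≤
      hardyA ^ 2 * ∫⁻ x, ENNReal.ofReal ((‖x‖ ^ p)⁻¹ * ‖fderiv ℝ f x‖) ^ 2 ∂μ := by
  set h : E → ℝ := fun x => (‖x‖ ^ p)⁻¹ * ‖fderiv ℝ f x‖ with hh
  have hhm : Measurable h := by
    have := (hf.continuous_fderiv one_ne_zero).norm.measurable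
    fun_prop
  have hh0 : ∀ x, 0 ≤ h x := fun x => by positivity
  have hfin : 0 < finrank ℝ E := by omega
  have : Nontrivial E := Module.nontrivial_of_finrank_pos hfin
  have hae : ∀ᵐ x ∂μ, x ≠ 0 := by
    exact (measure_eq_zero_iff_ae_notMem.1 (measure_singleton (μ := μ) (0 : E))).mono
      fun x hx => hx
  have step : ∀ x, x ≠ 0 → ENNReal.ofReal ((‖x‖ ^ (p + 1))⁻¹ * ‖f x‖) ^ 2 ≤
      hardyA * ∫⁻ t in Set.Ioi (1 : ℝ),
        ENNReal.ofReal (t ^ ((p : ℝ) + 3 / 4)) ^ 2 * ENNReal.ofReal (h (t • x)) ^ 2 := by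
    intro x hx
    have hn : 0 < ‖x‖ := norm_pos_iff.2 hx
    have h1 : ENNReal.ofReal ((‖x‖ ^ (p + 1))⁻¹ * ‖f x‖) ≤ ∫⁻ t in Set.Ioi (1 : ℝ),
        ENNReal.ofReal (t ^ (-(3 / 4) : ℝ)) *
          (ENNReal.ofReal (t ^ ((p : ℝ) + 3 / 4)) * ENNReal.ofReal (h (t • x))) := by
      rw [ENNReal.ofReal_mul (by positivity), ofReal_norm]
      calc _ ≤ ENNReal.ofReal (‖x‖ ^ (p + 1))⁻¹ *
            ∫⁻ t in Set.Ioi (1 : ℝ), ENNReal.ofReal (‖fderiv ℝ f (t • x)‖ * ‖x‖) := by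
            gcongr; exact ray_bound f hf hdec x hx
        _ = ∫⁻ t in Set.Ioi (1 : ℝ), ENNReal.ofReal (‖x‖ ^ (p + 1))⁻¹ *
              ENNReal.ofReal (‖fderiv ℝ f (t • x)‖ * ‖x‖) := by
            rw [lintegral_const_mul' _ _ ENNReal.ofReal_ne_top]
        _ = _ := by
            refine setLIntegral_congr_fun measurableSet_Ioi fun t ht => ?_
            have ht0 : (0 : ℝ) < t := lt_trans one_pos ht
            rw [← ENNReal.ofReal_mul (by positivity), ← ENNReal.ofReal_mul (by positivity),
              ← ENNReal.ofReal_mul (by positivity)]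
            congr 1
            rw [← mul_assoc (t ^ _), ← Real.rpow_add ht0]
            have : (-(3 / 4) + ((p : ℝ) + 3 / 4)) = (p : ℕ) := by ring
            rw [this, Real.rpow_natCast, hh]
            simp only [norm_smul, Real.norm_of_nonneg ht0.le]
            field_simp
            ring
    calc _ ≤ _ := by gcongr
      _ ≤ _ := cs_lintegral _ (by fun_prop) (by fun_prop)
      _ = _ := by simp only [mul_pow, hardyA]
  calc _ ≤ ∫⁻ x, hardyA * (∫⁻ t in Set.Ioi (1 : ℝ),
        ENNReal.ofReal (t ^ ((p : ℝ) + 3 / 4)) ^ 2 * ENNReal.ofReal (h (t • x)) ^ 2) ∂μ :=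
        lintegral_mono_ae (hae.mono step)
    _ = hardyA * ∫⁻ x, (∫⁻ t in Set.Ioi (1 : ℝ),
        ENNReal.ofReal (t ^ ((p : ℝ) + 3 / 4)) ^ 2 * ENNReal.ofReal (h (t • x)) ^ 2) ∂μ :=
        lintegral_const_mul' _ _ hardyA_lt_top.ne
    _ = hardyA * ∫⁻ t in Set.Ioi (1 : ℝ), (∫⁻ x, 
        ENNReal.ofReal (t ^ ((p : ℝ) + 3 / 4)) ^ 2 * ENNReal.ofReal (h (t • x)) ^ 2 ∂μ) := by
        rw [lintegral_lintegral_swap]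
        apply Measurable.aemeasurable
        have : Measurable (fun q : E × ℝ => q.2 • q.1) := by fun_prop
        have := hhm.comp this
        simp only [Function.uncurry_def]
        simp only [Function.comp_def] at this
        fun_prop
    _ ≤ hardyA * ∫⁻ t in Set.Ioi (1 : ℝ), ENNReal.ofReal (t ^ (-(3 / 4) : ℝ)) ^ 2 *
          ∫⁻ x, ENNReal.ofReal (h x) ^ 2 ∂μ := by
        refine mul_le_mul' le_rfl ?_
        refine setLIntegral_mono' measurableSet_Ioi fun t ht => ?_
        have ht0 : (0 : ℝ) < t := lt_trans one_pos ht
        rw [lintegral_const_mul' _ _ (by finiteness),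
          lintegral_smul_arg μ (fun x => ENNReal.ofReal (h x) ^ 2) (by fun_prop) ht0, ← mul_assoc]
        gcongr
        rw [← ENNReal.ofReal_pow (by positivity), ← ENNReal.ofReal_pow (by positivity),
          ← ENNReal.ofReal_mul (by positivity)]
        apply ENNReal.ofReal_le_ofReal
        rw [← Real.rpow_natCast, ← Real.rpow_natCast, ← Real.rpow_natCast, ← Real.rpow_mul ht0.le,
          ← Real.rpow_neg ht0.le, ← Real.rpow_mul ht0.le, ← Real.rpow_add ht0]
        apply Real.rpow_le_rpow_of_exponent_le (le_of_lt ht)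
        have : (2 * (p + 1) + 1 : ℝ) ≤ finrank ℝ E := by exact_mod_cast hp
        push_cast
        linarith
    _ = _ := by
        rw [lintegral_mul_const _ (by fun_prop), ← mul_assoc, sq]
        rfl

lemma hardy_iter (μ : Measure E) [μ.IsAddHaarMeasure] (v : 𝓢(E, F)) (d j : ℕ)
    (hd : 2 * d < finrank ℝ E) :
    ∫⁻ x, ENNReal.ofReal ((‖x‖ ^ d)⁻¹ * ‖iteratedFDeriv ℝ j v x‖) ^ 2 ∂μ ≤
      (hardyA ^ 2) ^ d * ∫⁻ x, ENNReal.ofReal (‖iteratedFDeriv ℝ (j + d) v x‖) ^ 2 ∂μ := by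
  induction d generalizing j with
  | zero => simp
  | succ d ih =>
    have h1 := hardy μ (iteratedFDeriv ℝ j v)
      ((v.smooth ⊤).iteratedFDeriv_right (i := j) (m := 1) (by
        exact_mod_cast le_top)) (by
        have : ProperSpace E := FiniteDimensional.proper ℝ E
        rw [tendsto_zero_iff_norm_tendsto_zero]
        obtain ⟨C, hC0, hC⟩ := v.decay 1 j
        have ht : Filter.Tendsto (fun x : E => C * ‖x‖⁻¹) (Filter.cocompact E) (nhds 0) := by
          have := ((tendsto_norm_cocompact_atTop (E := E)).inv_tendsto_atTop).const_mul C
          simpa using this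
        refine squeeze_zero' (Filter.Eventually.of_forall fun x => norm_nonneg _) ?_ ht
        have := (tendsto_norm_cocompact_atTop (E := E)).eventually_gt_atTop 0
        filter_upwards [this] with x hx
        rw [← div_eq_mul_inv, le_div_iff₀ hx]
        have := hC x
        simpa [mul_comm] using this) d hd
    refine h1.trans ?_
    simp only [norm_fderiv_iteratedFDeriv]
    have h2 := ih (j + 1) (by omega)
    calc _ ≤ hardyA ^ 2 * ((hardyA ^ 2) ^ d * ∫⁻ x, ENNReal.ofReal (‖iteratedFDeriv ℝ (j + 1 + d) v x‖) ^ 2 ∂μ) := by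
            gcongr
      _ = _ := by
        rw [← mul_assoc, ← pow_succ', show j + 1 + d = j + (d + 1) by ring]

end PW

namespace PW
open Module

variable {E : Type*} [NormedAddCommGroup E] [NormedSpace ℝ E]

/-- the standing assumptions on `ψ` and its inverse `φ` -/
structure Hom (ψ φ : E → E) : Prop where
  cd : ContDiffOn ℝ (⊤ : ℕ∞) ψ (S E)
  cdi : ContDiffOn ℝ (⊤ : ℕ∞) φ (S E)
  ne : ∀ x ∈ S E, ψ x ∈ S E
  nei : ∀ x ∈ S E, φ x ∈ S E
  left : ∀ x ∈ S E, φ (ψ x) = x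
  right : ∀ x ∈ S E, ψ (φ x) = x
  hom : ∀ a : ℝ, 0 < a → ∀ x ∈ S E, ψ (a • x) = a • ψ x
  homi : ∀ a : ℝ, 0 < a → ∀ x ∈ S E, φ (a • x) = a • φ x

lemma Hom.symm {ψ φ : E → E} (h : Hom ψ φ) : Hom φ ψ :=
  ⟨h.cdi, h.cd, h.nei, h.ne, h.right, h.left, h.homi, h.hom⟩

/-- Jacobian -/
def Jac (φ : E → E) (x : E) : ℝ := |(fderiv ℝ φ x).det|

variable [FiniteDimensional ℝ E]

lemma Hom.bound {ψ φ : E → E} (h : Hom ψ φ) : ∃ c : ℝ, 1 ≤ c ∧ ∀ x ∈ S E, ‖ψ x‖ ≤ c * ‖x‖ := by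
  obtain ⟨C, h1, hC⟩ := NN_homog 0 1 ψ h.cd (by simpa using h.hom)
  refine ⟨C, h1, fun x hx => ?_⟩
  have := hC x hx
  simpa [NN] using this

lemma Hom.lower {ψ φ : E → E} (h : Hom ψ φ) : ∃ c : ℝ, 1 ≤ c ∧ ∀ x ∈ S E, ‖x‖ ≤ c * ‖ψ x‖ := by
  obtain ⟨c, h1, hc⟩ := h.symm.bound
  refine ⟨c, h1, fun x hx => ?_⟩
  have := hc _ (h.ne x hx)
  rwa [h.left x hx] at this

lemma contDiff_det : ContDiff ℝ (⊤ : ℕ∞) (fun L : E →L[ℝ] E => L.det) := by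
  let b := finBasis ℝ E
  have h : (fun L : E →L[ℝ] E => L.det) =
      fun L => ∑ σ : Equiv.Perm (Fin (finrank ℝ E)), Equiv.Perm.sign σ •
        ∏ i, b.coord (σ i) (L (b i)) := by
    ext L
    rw [ContinuousLinearMap.det, ← LinearMap.det_toMatrix b, Matrix.det_apply]
    refine Finset.sum_congr rfl fun σ _ => ?_
    congr 1
    refine Finset.prod_congr rfl fun i _ => ?_
    simp [LinearMap.toMatrix_apply]
  rw [h]
  refine ContDiff.sum fun σ _ => ?_
  refine ContDiff.const_smul _ ?_
  refine contDiff_prod fun i _ => ?_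
  let l : (E →L[ℝ] E) →L[ℝ] ℝ := (LinearMap.toContinuousLinearMap (b.coord (σ i))).comp
    (ContinuousLinearMap.apply ℝ E (b i))
  exact l.contDiff

lemma Hom.hasFDeriv {ψ φ : E → E} (h : Hom ψ φ) {x : E} (hx : x ∈ S E) :
    HasFDerivAt ψ (fderiv ℝ ψ x) x :=
  ((h.cd.contDiffAt (isOpenS.mem_nhds hx)).differentiableAt (by simp)).hasFDerivAt

lemma Hom.det_ne {ψ φ : E → E} (h : Hom ψ φ) {x : E} (hx : x ∈ S E) :
    (fderiv ℝ ψ x).det ≠ 0 := by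
  have h1 := (h.symm.hasFDeriv (h.ne x hx)).comp x (h.hasFDeriv hx)
  have h2 : HasFDerivAt (φ ∘ ψ) (ContinuousLinearMap.id ℝ E) x := by
    refine (hasFDerivAt_id x).congr_of_eventuallyEq ?_
    filter_upwards [isOpenS.mem_nhds hx] with y hy using h.left y hy
  have h3 := h1.unique h2
  have h4 : (fderiv ℝ φ (ψ x)).det * (fderiv ℝ ψ x).det = 1 := by
    have := congrArg ContinuousLinearMap.det h3
    simpa [ContinuousLinearMap.det] using this
  intro h0
  rw [h0, mul_zero] at h4
  exact zero_ne_one h4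

lemma Hom.fderiv_cd {ψ φ : E → E} (h : Hom ψ φ) : ContDiffOn ℝ (⊤ : ℕ∞) (fderiv ℝ ψ) (S E) :=
  h.cd.fderiv_of_isOpen isOpenS (by simp)

lemma Hom.jac_cd {ψ φ : E → E} (h : Hom ψ φ) : ContDiffOn ℝ (⊤ : ℕ∞) (Jac ψ) (S E) := by
  have h1 : ContDiffOn ℝ (⊤ : ℕ∞) (fun x => (fderiv ℝ ψ x).det) (S E) :=
    contDiff_det.comp_contDiffOn h.fderiv_cd
  intro x hx
  exact (contDiffAt_abs (h.det_ne hx)).comp_contDiffWithinAt x (h1 x hx)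

lemma Hom.jac_hom {ψ φ : E → E} (h : Hom ψ φ) (a : ℝ) (ha : 0 < a) (x : E) (hx : x ∈ S E) :
    Jac ψ (a • x) = Jac ψ x := by
  have hax : a • x ∈ S E := by
    have : x ≠ 0 := hx
    simp [ha.ne', this]
  have h1 : HasFDerivAt (fun y => ψ (a • y)) (a • fderiv ℝ ψ (a • x)) x := by
    have h2 : HasFDerivAt (fun y : E => a • y) (a • ContinuousLinearMap.id ℝ E) x :=
      (hasFDerivAt_id x).const_smul a
    have h3 := (h.hasFDeriv hax).comp x h2
    convert! h3 using 1
    ext z; simp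
  have h2 : HasFDerivAt (fun y => ψ (a • y)) (a • fderiv ℝ ψ x) x := by
    refine ((h.hasFDeriv hx).const_smul a).congr_of_eventuallyEq ?_
    filter_upwards [isOpenS.mem_nhds hx] with y hy using h.hom a ha y hy
  have h3 : fderiv ℝ ψ (a • x) = fderiv ℝ ψ x := smul_right_injective _ ha.ne' (h1.unique h2)
  rw [Jac, Jac, h3]

lemma Hom.jac_bound {ψ φ : E → E} (h : Hom ψ φ) (k : ℕ) :
    ∃ C : ℝ, 1 ≤ C ∧ ∀ x ∈ S E, NN k (Jac ψ) x ≤ C := by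
  obtain ⟨C, h1, hC⟩ := NN_homog k 0 (Jac ψ) h.jac_cd (by simpa using h.jac_hom)
  exact ⟨C, h1, by simpa using hC⟩

variable [MeasurableSpace E] [BorelSpace E] [Nontrivial E]

lemma restrictS (μ : Measure E) [μ.IsAddHaarMeasure] : μ.restrict (S E) = μ := by
  rw [Measure.restrict_eq_self_of_ae_mem]
  exact (measure_eq_zero_iff_ae_notMem.1 (measure_singleton (μ := μ) (0 : E))).mono
      fun x hx => hx

lemma ae_S (μ : Measure E) [μ.IsAddHaarMeasure] : ∀ᵐ x ∂μ, x ∈ S E :=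
  (measure_eq_zero_iff_ae_notMem.1 (measure_singleton (μ := μ) (0 : E))).mono
      fun x hx => hx

lemma Hom.injOn {ψ φ : E → E} (h : Hom ψ φ) : Set.InjOn φ (S E) := by
  intro x hx y hy hxy
  rw [← h.right x hx, ← h.right y hy, hxy]

lemma Hom.image {ψ φ : E → E} (h : Hom ψ φ) : Set.image φ (S E) = S E := by
  ext y
  constructor
  · rintro ⟨x, hx, rfl⟩; exact h.nei x hx
  · intro hy; exact ⟨ψ y, h.ne y hy, h.left y hy⟩

lemma Hom.cov {ψ φ : E → E} (h : Hom ψ φ) (μ : Measure E) [μ.IsAddHaarMeasure] (g : E → ℝ≥0∞) :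
    ∫⁻ x, g (ψ x) ∂μ = ∫⁻ y, ENNReal.ofReal (Jac φ y) * g y ∂μ := by
  have := lintegral_image_eq_lintegral_abs_det_fderiv_mul μ (isOpenS (E := E)).measurableSet
    (fun x hx => (h.symm.hasFDeriv hx).hasFDerivWithinAt) h.injOn (fun x => g (ψ x))
  rw [h.image, restrictS] at this
  rw [this]
  refine lintegral_congr_ae ?_
  filter_upwards [ae_S μ] with y hy
  rw [h.right y hy, Jac]

lemma Hom.cov_int {ψ φ : E → E} (h : Hom ψ φ) (μ : Measure E) [μ.IsAddHaarMeasure] (g : E → ℂ) :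
    ∫ x, g (x) ∂μ = ∫ y, Jac φ y • g (φ y) ∂μ := by
  have := integral_image_eq_integral_abs_det_fderiv_smul μ (isOpenS (E := E)).measurableSet
    (fun x hx => (h.symm.hasFDeriv hx).hasFDerivWithinAt) h.injOn g
  rw [h.image, restrictS] at this
  rw [this]
  rfl

lemma Hom.cov_le {ψ φ : E → E} (h : Hom ψ φ) (μ : Measure E) [μ.IsAddHaarMeasure] :
    ∃ C : ℝ, ∀ g : E → ℝ≥0∞, ∫⁻ x, g (ψ x) ∂μ ≤ ENNReal.ofReal C * ∫⁻ y, g y ∂μ := by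
  obtain ⟨C, h1, hC⟩ := h.symm.jac_bound 0
  refine ⟨C, fun g => ?_⟩
  rw [h.cov μ g, ← lintegral_const_mul' _ _ ENNReal.ofReal_ne_top]
  refine lintegral_mono_ae ?_
  filter_upwards [ae_S μ] with y hy
  gcongr
  have := hC y hy
  simp [NN] at this
  exact (le_abs_self _).trans this

lemma key (μ : Measure E) [μ.IsAddHaarMeasure] {ψ φ : E → E} (h : Hom ψ φ) (k : ℕ)
    (hk : 2 * k < finrank ℝ E) (M : ℝ) :
    ∃ C : ℝ≥0∞, C ≠ ⊤ ∧ ∀ b : E → ℂ, ContDiffOn ℝ (⊤ : ℕ∞) b (S E) → (∀ x ∈ S E, NN k b x ≤ M) →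
      ∀ v G : 𝓢(E, ℂ), (∀ x ∈ S E, G x = b x * v (ψ x)) →
      ∫⁻ x, ENNReal.ofReal ‖iteratedFDeriv ℝ k G x‖ ^ 2 ∂μ ≤
        C * ∫⁻ x, ENNReal.ofReal ‖iteratedFDeriv ℝ k v x‖ ^ 2 ∂μ := by
  obtain ⟨c, hc1, hc⟩ := h.lower
  obtain ⟨c₂, hc₂1, hc₂⟩ := h.bound
  obtain ⟨C₁, hC₁0, hC₁⟩ := NN_comp (F := ℂ) k ψ h.cd h.ne h.hom c hc
  obtain ⟨CJ, hCJ⟩ := h.cov_le μ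
  set K : ℝ := c₂ ^ k * (2 ^ (2 * k + 1) * (|M| * C₁)) with hK
  have hK0 : 0 ≤ K := by positivity
  set A : ℝ≥0∞ := ∑ j ∈ Finset.range (k + 1), (hardyA ^ 2) ^ (k - j)
  have hA : A ≠ ⊤ := by
    refine ENNReal.sum_ne_top.2 fun j _ => ?_
    have := hardyA_lt_top.ne
    finiteness
  refine ⟨ENNReal.ofReal CJ * (ENNReal.ofReal (K ^ 2 * (k + 1)) * A), by finiteness,
    fun b hb hbM v G hG => ?_⟩
  have hv : ContDiffOn ℝ (⊤ : ℕ∞) v (S E) := (v.smooth ⊤).contDiffOn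
  have hvψ : ContDiffOn ℝ (⊤ : ℕ∞) (fun z => v (ψ z)) (S E) := hv.comp h.cd h.ne
  set t : ℕ → E → ℝ := fun j y => (‖y‖ ^ (k - j))⁻¹ * ‖iteratedFDeriv ℝ j v y‖
  have hw : ∀ (f : 𝓢(E, ℂ)) j, ∀ x ∈ S E,
      iteratedFDerivWithin ℝ j f (S E) x = iteratedFDeriv ℝ j f x :=
    fun f j x hx => iteratedFDerivWithin_of_isOpen j isOpenS hx
  have hpt : ∀ x ∈ S E, ‖iteratedFDeriv ℝ k G x‖ ≤ K * ∑ j ∈ Finset.range (k + 1), t j (ψ x) := by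
    intro x hx
    have hx0 : 0 < ‖x‖ := norm_pos_iff.2 hx
    have hy0 : 0 < ‖ψ x‖ := norm_pos_iff.2 (h.ne x hx)
    have e1 : ‖x‖ ^ k * ‖iteratedFDeriv ℝ k G x‖ ≤
        2 ^ (2 * k + 1) * (|M| * C₁) * NN k v (ψ x) := by
      calc ‖x‖ ^ k * ‖iteratedFDeriv ℝ k G x‖ ≤ NN k G x := by
            rw [← hw G k x hx]; exact le_NN le_rfl _ _
        _ = NN k (fun z => b z * v (ψ z)) x := NN_congr hG hx
        _ ≤ 2 ^ (2 * k + 1) * (NN k b x * NN k (fun z => v (ψ z)) x) := NN_mul k _ _ hb hvψ hx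
        _ ≤ 2 ^ (2 * k + 1) * (|M| * (C₁ * NN k v (ψ x))) := by
            gcongr
            · exact NN_nonneg _ _ _
            · exact (hbM x hx).trans (le_abs_self _)
            · exact hC₁ v hv x hx
        _ = _ := by ring
    have e2 : NN k v (ψ x) = ‖ψ x‖ ^ k * ∑ j ∈ Finset.range (k + 1), t j (ψ x) := by
      unfold NN
      rw [Finset.mul_sum]
      refine Finset.sum_congr rfl fun j hj => ?_
      have hj' : j ≤ k := Nat.lt_succ_iff.1 (Finset.mem_range.1 hj)
      rw [hw v j _ (h.ne x hx)]
      have : ‖ψ x‖ ^ k = ‖ψ x‖ ^ j * ‖ψ x‖ ^ (k - j) := by rw [← pow_add, Nat.add_sub_cancel' hj']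
      simp only [t, this]
      field_simp
    have hs : 0 ≤ ∑ j ∈ Finset.range (k + 1), t j (ψ x) :=
      Finset.sum_nonneg fun j _ => by positivity
    have e3 : ‖x‖ ^ k * ‖iteratedFDeriv ℝ k G x‖ ≤
        ‖x‖ ^ k * (K * ∑ j ∈ Finset.range (k + 1), t j (ψ x)) := by
      refine e1.trans ?_
      rw [e2]
      calc _ ≤ 2 ^ (2 * k + 1) * (|M| * C₁) *
            ((c₂ * ‖x‖) ^ k * ∑ j ∈ Finset.range (k + 1), t j (ψ x)) := by
            gcongr; exact hc₂ x hx
        _ = _ := by rw [hK]; ring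
    exact le_of_mul_le_mul_left e3 (by positivity)
  have hpt2 : ∀ x ∈ S E, ENNReal.ofReal ‖iteratedFDeriv ℝ k G x‖ ^ 2 ≤
      ENNReal.ofReal (K ^ 2 * (k + 1)) * ∑ j ∈ Finset.range (k + 1), ENNReal.ofReal (t j (ψ x)) ^ 2 := by
    intro x hx
    have ht0 : ∀ j, 0 ≤ t j (ψ x) := fun j => by positivity
    rw [← ENNReal.ofReal_pow (by positivity)]
    simp_rw [← ENNReal.ofReal_pow (ht0 _)]
    rw [← ENNReal.ofReal_sum_of_nonneg (fun j _ => by positivity),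
      ← ENNReal.ofReal_mul (by positivity)]
    apply ENNReal.ofReal_le_ofReal
    have := sq_sum_le_card_mul_sum_sq (s := Finset.range (k + 1)) (f := fun j => t j (ψ x))
    rw [Finset.card_range] at this
    push_cast at this
    calc _ ≤ (K * ∑ j ∈ Finset.range (k + 1), t j (ψ x)) ^ 2 := by gcongr; exact hpt x hx
      _ = K ^ 2 * (∑ j ∈ Finset.range (k + 1), t j (ψ x)) ^ 2 := by ring
      _ ≤ K ^ 2 * ((k + 1) * ∑ j ∈ Finset.range (k + 1), t j (ψ x) ^ 2) := by gcongr
      _ = _ := by ring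
  have htm : ∀ j, Measurable (t j) := by
    intro j
    have : Continuous (fun y => ‖iteratedFDeriv ℝ j v y‖) :=
      ((v.smooth ⊤).continuous_iteratedFDeriv (m := j) (by exact_mod_cast le_top)).norm
    have := this.measurable
    fun_prop
  calc _ ≤ ∫⁻ x, ENNReal.ofReal (K ^ 2 * (k + 1)) *
        ∑ j ∈ Finset.range (k + 1), ENNReal.ofReal (t j (ψ x)) ^ 2 ∂μ :=
        lintegral_mono_ae ((ae_S μ).mono hpt2)
    _ ≤ ENNReal.ofReal CJ * ∫⁻ y, ENNReal.ofReal (K ^ 2 * (k + 1)) *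
        ∑ j ∈ Finset.range (k + 1), ENNReal.ofReal (t j y) ^ 2 ∂μ :=
        hCJ (fun y => ENNReal.ofReal (K ^ 2 * (k + 1)) *
          ∑ j ∈ Finset.range (k + 1), ENNReal.ofReal (t j y) ^ 2)
    _ = ENNReal.ofReal CJ * (ENNReal.ofReal (K ^ 2 * (k + 1)) *
        ∑ j ∈ Finset.range (k + 1), ∫⁻ y, ENNReal.ofReal (t j y) ^ 2 ∂μ) := by
        rw [lintegral_const_mul' _ _ ENNReal.ofReal_ne_top, lintegral_finsetSum]
        intro j _
        have := htm j
        fun_prop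
    _ ≤ ENNReal.ofReal CJ * (ENNReal.ofReal (K ^ 2 * (k + 1)) *
        ∑ j ∈ Finset.range (k + 1), ((hardyA ^ 2) ^ (k - j) *
          ∫⁻ x, ENNReal.ofReal ‖iteratedFDeriv ℝ k v x‖ ^ 2 ∂μ)) := by
        gcongr with j hj
        have hj' : j ≤ k := Nat.lt_succ_iff.1 (Finset.mem_range.1 hj)
        have := hardy_iter μ v (k - j) j (by omega)
        rwa [Nat.add_sub_cancel' hj'] at this
    _ = _ := by rw [← Finset.sum_mul]; ring

end PW

namespace PW
open Module LineDeriv FourierTransform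

section four
variable {E : Type*} [NormedAddCommGroup E] [InnerProductSpace ℝ E] [FiniteDimensional ℝ E]
  [MeasurableSpace E] [BorelSpace E]

/-- squared `L²` size -/
def Q (h : E → ℝ) : ℝ≥0∞ := ∫⁻ x, ENNReal.ofReal (h x) ^ 2

lemma Q_mono {h g : E → ℝ} (H : ∀ x, h x ≤ g x) : Q h ≤ Q g := by
  unfold Q
  gcongr with x
  exact H x

lemma Q_const {c : ℝ} (hc : 0 ≤ c) (h : E → ℝ) : Q (fun x => c * h x) = ENNReal.ofReal (c ^ 2) * Q h := by
  unfold Q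
  rw [← lintegral_const_mul' _ _ ENNReal.ofReal_ne_top]
  simp_rw [ENNReal.ofReal_mul hc, mul_pow, ENNReal.ofReal_pow hc]

lemma Q_eq (f : 𝓢(E, ℂ)) : Q (fun x => ‖f x‖) = ENNReal.ofReal (∫ x, ‖f x‖ ^ 2) := by
  unfold Q
  rw [ofReal_integral_eq_lintegral_ofReal]
  · simp_rw [ENNReal.ofReal_pow (norm_nonneg _)]
  · have := (f.memLp 2 (volume : Measure E)).integrable_norm_pow (by norm_num)
    simpa using this
  · exact Filter.Eventually.of_forall fun x => by positivity

lemma Q_fourier (f : 𝓢(E, ℂ)) : Q (fun x => ‖(𝓕 f : 𝓢(E, ℂ)) x‖) = Q (fun x => ‖f x‖) := by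
  rw [Q_eq, Q_eq, integral_norm_sq_fourier]

lemma iter_fourier (k : ℕ) (m : Fin k → E) : ∀ f : 𝓢(E, ℂ),
    ∃ g : 𝓢(E, ℂ), ∂^{m} (𝓕 f) = 𝓕 g ∧
      ∀ x, g x = (-(2 * (π : ℂ) * I)) ^ k * ((∏ i, inner ℝ x (m i) : ℝ) : ℂ) * f x := by
  induction k with
  | zero => intro f; exact ⟨f, by simp, by simp⟩
  | succ k ih =>
    intro f
    rw [iteratedLineDerivOp_succ_right, lineDerivOp_fourier_eq]
    obtain ⟨g, h1, h2⟩ := ih (Fin.init m)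
      (-(2 * (π : ℂ) * I) • (smulLeftCLM ℂ fun x => inner ℝ x (m (Fin.last k))) f)
    refine ⟨g, h1, fun x => ?_⟩
    rw [h2, Fin.prod_univ_castSucc]
    simp only [_root_.smul_apply]
    rw [smulLeftCLM_apply_apply (by fun_prop)]
    simp only [Fin.init, smul_eq_mul, Complex.real_smul]
    push_cast
    ring

lemma Q_dir (k : ℕ) (m : Fin k → E) (f : 𝓢(E, ℂ)) :
    Q (fun x => ‖iteratedFDeriv ℝ k (𝓕 f : 𝓢(E, ℂ)) x m‖) =
      Q (fun x => (2 * π) ^ k * (|∏ i, inner ℝ x (m i)| * ‖f x‖)) := by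
  obtain ⟨g, h1, h2⟩ := iter_fourier k m f
  have : ∀ x, iteratedFDeriv ℝ k (𝓕 f : 𝓢(E, ℂ)) x m = (𝓕 g : 𝓢(E, ℂ)) x := by
    intro x; rw [← h1, iteratedLineDerivOp_eq_iteratedFDeriv]
  simp_rw [this]
  rw [Q_fourier]
  congr 1
  ext x
  rw [h2, norm_mul, norm_mul, norm_pow, norm_neg, norm_mul, norm_mul, Complex.norm_real,
    Complex.norm_real, Complex.norm_I, Real.norm_of_nonneg Real.pi_pos.le, Real.norm_eq_abs]
  simp [mul_assoc]

lemma F1 [Nontrivial E] (k : ℕ) : ∃ C : ℝ, ∀ f : 𝓢(E, ℂ),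
    Q (fun x => ‖x‖ ^ k * ‖f x‖) ≤ ENNReal.ofReal C * Q (fun x => ‖iteratedFDeriv ℝ k (𝓕 f : 𝓢(E, ℂ)) x‖) := by
  set e := stdOrthonormalBasis ℝ E
  set N := finrank ℝ E with hN
  have hN0 : 0 < N := finrank_pos
  have hN1 : (1 : ℝ) ≤ N := by exact_mod_cast hN0
  refine ⟨((N : ℝ) ^ k) ^ 2 * N, fun f => ?_⟩
  have hx : ∀ x : E, ∃ i, ‖x‖ ≤ N * |inner ℝ x (e i)| := by
    intro x
    have : Nonempty (Fin (finrank ℝ E)) := ⟨⟨0, hN0⟩⟩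
    have h1 : ∑ i : Fin (finrank ℝ E), ‖x‖ ^ 2 / N ≤ ∑ i, inner ℝ x (e i) ^ 2 := by
      have h2 := e.sum_sq_inner_left x
      have h3 : ∑ i, inner ℝ x (e i) ^ 2 = ‖x‖ ^ 2 := by rw [← h2]
      rw [h3, Finset.sum_const, Finset.card_univ, Fintype.card_fin, nsmul_eq_mul]
      apply le_of_eq
      rw [← hN]; field_simp
    obtain ⟨i, _, hi⟩ := Finset.exists_le_of_sum_le (Finset.univ_nonempty) h1
    refine ⟨i, ?_⟩
    apply abs_le_of_sq_le_sq' _ (by positivity) |>.2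
    rw [mul_pow, sq_abs]
    rw [div_le_iff₀ (by positivity)] at hi
    refine hi.trans ?_
    nlinarith [sq_nonneg (inner ℝ x (e i))]
  have hdir : ∀ i, Q (fun x => |inner ℝ x (e i)| ^ k * ‖f x‖) ≤
      Q (fun x => ‖iteratedFDeriv ℝ k (𝓕 f : 𝓢(E, ℂ)) x‖) := by
    intro i
    calc _ ≤ Q (fun x => (2 * π) ^ k * (|∏ j : Fin k, inner ℝ x (e i)| * ‖f x‖)) := by
          refine Q_mono fun x => ?_
          rw [Finset.prod_const, Finset.card_univ, Fintype.card_fin, abs_pow]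
          have : (1:ℝ) ≤ (2 * π) ^ k := one_le_pow₀ (by linarith [Real.pi_gt_three])
          exact le_mul_of_one_le_left (by positivity) this
      _ = Q (fun x => ‖iteratedFDeriv ℝ k (𝓕 f : 𝓢(E, ℂ)) x (fun _ => e i)‖) := (Q_dir k _ f).symm
      _ ≤ _ := by
          refine Q_mono fun x => ?_
          refine (ContinuousMultilinearMap.le_opNorm _ _).trans ?_
          simp
  have hpt : ∀ x, ENNReal.ofReal (‖x‖ ^ k * ‖f x‖) ^ 2 ≤ ENNReal.ofReal (((N : ℝ) ^ k) ^ 2) *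
      ∑ i, ENNReal.ofReal (|inner ℝ x (e i)| ^ k * ‖f x‖) ^ 2 := by
    intro x
    obtain ⟨i, hi⟩ := hx x
    refine le_trans ?_ (mul_le_mul_right (Finset.single_le_sum
      (f := fun i => ENNReal.ofReal (|inner ℝ x (e i)| ^ k * ‖f x‖) ^ 2)
      (fun _ _ => zero_le) (Finset.mem_univ i)) _)
    rw [ENNReal.ofReal_pow (by positivity), ← mul_pow, ← ENNReal.ofReal_mul (by positivity)]
    rw [← mul_assoc, ← mul_pow]
    gcongr
  calc _ ≤ ∫⁻ x, ENNReal.ofReal (((N : ℝ) ^ k) ^ 2) *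
      ∑ i, ENNReal.ofReal (|inner ℝ x (e i)| ^ k * ‖f x‖) ^ 2 := lintegral_mono hpt
    _ = ENNReal.ofReal (((N : ℝ) ^ k) ^ 2) *
      ∑ i, Q (fun x => |inner ℝ x (e i)| ^ k * ‖f x‖) := by
      rw [lintegral_const_mul' _ _ ENNReal.ofReal_ne_top, lintegral_finsetSum]
      · rfl
      · intro i _
        have := f.continuous
        fun_prop
    _ ≤ ENNReal.ofReal (((N : ℝ) ^ k) ^ 2) *
      ∑ i : Fin (finrank ℝ E), Q (fun x => ‖iteratedFDeriv ℝ k (𝓕 f : 𝓢(E, ℂ)) x‖) := by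
      gcongr with i
      exact hdir i
    _ = _ := by
      rw [Finset.sum_const, Finset.card_univ, Fintype.card_fin, nsmul_eq_mul,
        ENNReal.ofReal_mul (by positivity), ENNReal.ofReal_natCast, mul_assoc]

lemma F2 (k : ℕ) : ∃ C : ℝ, ∀ f : 𝓢(E, ℂ),
    Q (fun x => ‖iteratedFDeriv ℝ k (𝓕 f : 𝓢(E, ℂ)) x‖) ≤ ENNReal.ofReal C * Q (fun x => ‖x‖ ^ k * ‖f x‖) := by
  set e := stdOrthonormalBasis ℝ E
  set c : ℕ := Fintype.card (Fin k → Fin (finrank ℝ E))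
  refine ⟨c * (c * ((2 * π) ^ k) ^ 2), fun f => ?_⟩
  have hop : ∀ T : ContinuousMultilinearMap ℝ (fun _ : Fin k => E) ℂ,
      ‖T‖ ≤ ∑ r : Fin k → Fin (finrank ℝ E), ‖T (fun i => e (r i))‖ := by
    intro T
    refine ContinuousMultilinearMap.opNorm_le_bound (by positivity) fun m => ?_
    have h1 : m = fun i => ∑ j, inner ℝ (e j) (m i) • e j := by
      ext1 i; exact (e.sum_repr' (m i)).symm
    have h2 : T m = ∑ r : Fin k → Fin (finrank ℝ E),
        (∏ i, inner ℝ (e (r i)) (m i)) • T (fun i => e (r i)) := by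
      conv_lhs => rw [h1]
      rw [ContinuousMultilinearMap.map_sum]
      refine Finset.sum_congr rfl fun r _ => ?_
      rw [← ContinuousMultilinearMap.map_smul_univ]
    rw [h2, Finset.sum_mul]
    refine (norm_sum_le _ _).trans (Finset.sum_le_sum fun r _ => ?_)
    rw [norm_smul, mul_comm, norm_prod]
    gcongr with i
    refine (norm_inner_le_norm _ _).trans ?_
    simp
  have hpt : ∀ x, ENNReal.ofReal ‖iteratedFDeriv ℝ k (𝓕 f : 𝓢(E, ℂ)) x‖ ^ 2 ≤ ENNReal.ofReal c *
      ∑ r : Fin k → Fin (finrank ℝ E),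
        ENNReal.ofReal ‖iteratedFDeriv ℝ k (𝓕 f : 𝓢(E, ℂ)) x (fun i => e (r i))‖ ^ 2 := by
    intro x
    simp_rw [← ENNReal.ofReal_pow (norm_nonneg _)]
    rw [← ENNReal.ofReal_sum_of_nonneg (fun j _ => by positivity),
      ← ENNReal.ofReal_mul (by positivity)]
    apply ENNReal.ofReal_le_ofReal
    have := sq_sum_le_card_mul_sum_sq (s := Finset.univ)
      (f := fun r : Fin k → Fin (finrank ℝ E) => ‖iteratedFDeriv ℝ k (𝓕 f : 𝓢(E, ℂ)) x (fun i => e (r i))‖)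
    refine le_trans ?_ this
    gcongr
    exact hop _
  have hdir : ∀ r : Fin k → Fin (finrank ℝ E),
      Q (fun x => ‖iteratedFDeriv ℝ k (𝓕 f : 𝓢(E, ℂ)) x (fun i => e (r i))‖) ≤
      ENNReal.ofReal (((2 * π) ^ k) ^ 2) * Q (fun x => ‖x‖ ^ k * ‖f x‖) := by
    intro r
    rw [Q_dir, Q_const (by positivity)]
    gcongr
    refine Q_mono fun x => ?_
    gcongr
    rw [Finset.abs_prod]
    calc _ ≤ ∏ i : Fin k, ‖x‖ := by
          gcongr with i
          refine (abs_real_inner_le_norm _ _).trans ?_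
          simp
      _ = _ := by simp
  calc _ ≤ ∫⁻ x, ENNReal.ofReal c * ∑ r : Fin k → Fin (finrank ℝ E),
        ENNReal.ofReal ‖iteratedFDeriv ℝ k (𝓕 f : 𝓢(E, ℂ)) x (fun i => e (r i))‖ ^ 2 := lintegral_mono hpt
    _ = ENNReal.ofReal c * ∑ r : Fin k → Fin (finrank ℝ E),
        Q (fun x => ‖iteratedFDeriv ℝ k (𝓕 f : 𝓢(E, ℂ)) x (fun i => e (r i))‖) := by
      rw [lintegral_const_mul' _ _ ENNReal.ofReal_ne_top, lintegral_finsetSum]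
      · rfl
      · intro r _
        have h1 : Continuous (fun y => iteratedFDeriv ℝ k (𝓕 f : 𝓢(E, ℂ)) y) :=
          ((𝓕 f : 𝓢(E, ℂ)).smooth ⊤).continuous_iteratedFDeriv (m := k) (by exact_mod_cast le_top)
        have : Continuous (fun y => iteratedFDeriv ℝ k (𝓕 f : 𝓢(E, ℂ)) y (fun i => e (r i))) := by fun_prop
        fun_prop
    _ ≤ ENNReal.ofReal c * ∑ r : Fin k → Fin (finrank ℝ E),
        ENNReal.ofReal (((2 * π) ^ k) ^ 2) * Q (fun x => ‖x‖ ^ k * ‖f x‖) := by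
      gcongr with r
      exact hdir r
    _ = _ := by
      rw [Finset.sum_const, Finset.card_univ, nsmul_eq_mul,
        ENNReal.ofReal_mul (by positivity), ENNReal.ofReal_mul (by positivity),
        ENNReal.ofReal_natCast]
      ring
end four
end PW

namespace PW
open Module LineDeriv FourierTransform

section wts
variable {E : Type*} [NormedAddCommGroup E]

/-- the weight -/
def w (s : ℝ) (x : E) : ℝ := (1 + ‖x‖ ^ 2) ^ (s / 2)

lemma w_pos (s : ℝ) (x : E) : 0 < w s x := Real.rpow_pos_of_pos (by positivity) _

lemma w_mul (s t : ℝ) (x : E) : w s x * w t x = w (s + t) x := by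
  unfold w
  rw [← Real.rpow_add (by positivity), add_div]

lemma w_continuous (s : ℝ) : Continuous (fun x : E => w s x) := by
  unfold w
  exact Continuous.rpow_const (by fun_prop) fun x => Or.inl (by positivity)

lemma w_zero (x : E) : w 0 x = 1 := by simp [w]

lemma w_nat (k : ℕ) (x : E) : w k x = Real.sqrt (1 + ‖x‖ ^ 2) ^ k := by
  unfold w
  rw [Real.sqrt_eq_rpow, ← Real.rpow_natCast _ k, ← Real.rpow_mul (by positivity)]
  congr 1; ring

lemma pow_le_w (k : ℕ) (x : E) : ‖x‖ ^ k ≤ w k x := by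
  rw [w_nat]
  gcongr
  apply Real.le_sqrt_of_sq_le
  linarith

lemma one_le_w (k : ℕ) (x : E) : 1 ≤ w k x := by
  rw [w_nat]
  apply one_le_pow₀
  apply Real.le_sqrt_of_sq_le
  nlinarith [sq_nonneg ‖x‖]

lemma w_le (k : ℕ) (x : E) : w k x ≤ 2 ^ k * (1 + ‖x‖ ^ k) := by
  rw [w_nat]
  have h : Real.sqrt (1 + ‖x‖ ^ 2) ≤ 1 + ‖x‖ := by
    rw [Real.sqrt_le_left (by positivity)]
    nlinarith [norm_nonneg x]
  have h1 : Real.sqrt (1 + ‖x‖ ^ 2) ≤ 2 * max 1 ‖x‖ := by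
    refine h.trans ?_
    linarith [le_max_left 1 ‖x‖, le_max_right 1 ‖x‖]
  calc _ ≤ (2 * max 1 ‖x‖) ^ k := by gcongr
    _ = 2 ^ k * (max 1 ‖x‖) ^ k := mul_pow _ _ _
    _ ≤ _ := by
      gcongr
      rcases max_cases 1 ‖x‖ with h | h <;> rw [h.1]
      · rw [one_pow]; linarith [pow_nonneg (norm_nonneg x) k]
      · linarith

end wts

section four
variable {E : Type*} [NormedAddCommGroup E] [InnerProductSpace ℝ E] [FiniteDimensional ℝ E]
  [MeasurableSpace E] [BorelSpace E]

lemma Q_w_le (k : ℕ) (f : 𝓢(E, ℂ)) : Q (fun x => w k x * ‖f x‖) ≤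
    ENNReal.ofReal (2 * (2 ^ k) ^ 2) * (Q (fun x => ‖f x‖) + Q (fun x => ‖x‖ ^ k * ‖f x‖)) := by
  unfold Q
  rw [← lintegral_add_left (by have := f.continuous; fun_prop),
    ← lintegral_const_mul' _ _ ENNReal.ofReal_ne_top]
  refine lintegral_mono fun x => ?_
  have := w_pos k x
  rw [← ENNReal.ofReal_pow (by positivity), ← ENNReal.ofReal_pow (by positivity),
    ← ENNReal.ofReal_pow (by positivity), ← ENNReal.ofReal_add (by positivity) (by positivity),
    ← ENNReal.ofReal_mul (by positivity)]
  apply ENNReal.ofReal_le_ofReal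
  calc (w k x * ‖f x‖) ^ 2 ≤ (2 ^ k * (1 + ‖x‖ ^ k) * ‖f x‖) ^ 2 := by
        gcongr; exact w_le k x
    _ ≤ _ := by
      have : (2 ^ k * (1 + ‖x‖ ^ k) * ‖f x‖) ^ 2 =
        (2 ^ k) ^ 2 * (‖f x‖ + ‖x‖ ^ k * ‖f x‖) ^ 2 := by ring
      rw [this, mul_comm 2, mul_assoc]
      gcongr
      nlinarith [sq_nonneg (‖f x‖ - ‖x‖ ^ k * ‖f x‖)]

lemma mk {b v : E → ℂ} (hb : ContDiffOn ℝ (⊤ : ℕ∞) b (S E)) (hv : ContDiffOn ℝ (⊤ : ℕ∞) v (S E))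
    {r R : ℝ} (hr : 0 < r) (ha : ∀ x, b x ≠ 0 → r ≤ ‖x‖ ∧ ‖x‖ ≤ R) :
    ∃ G : 𝓢(E, ℂ), ∀ x, G x = b x * v x := by
  have h1 : HasCompactSupport (fun x => b x * v x) := by
    refine HasCompactSupport.intro (isCompact_closedBall (0 : E) R) fun x hx => ?_
    have : b x = 0 := by
      by_contra h0
      exact hx (by simpa using (ha x h0).2)
    simp [this]
  have h2 : ContDiff ℝ (⊤ : ℕ∞) (fun x => b x * v x) := by
    rw [contDiff_iff_contDiffAt]
    intro x
    by_cases hx : x = 0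
    · subst hx
      refine (contDiffAt_const (c := (0 : ℂ))).congr_of_eventuallyEq ?_
      filter_upwards [Metric.ball_mem_nhds (0 : E) hr] with y hy
      have : b y = 0 := by
        by_contra h0
        have := (ha y h0).1
        simp at hy
        linarith
      simp [this]
    · exact (hb.mul hv).contDiffAt (isOpenS.mem_nhds hx)
  exact ⟨h1.toSchwartzMap h2, fun x => rfl⟩

variable [Nontrivial E]

lemma keyp {ψ φ : E → E} (h : Hom ψ φ) (k : ℕ)
    (hk : 2 * k < finrank ℝ E) (M : ℝ) :
    ∃ C : ℝ≥0∞, C ≠ ⊤ ∧ ∀ b : E → ℂ, ContDiffOn ℝ (⊤ : ℕ∞) b (S E) → (∀ x ∈ S E, NN k b x ≤ M) →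
      ∀ u W : 𝓢(E, ℂ), (∀ x ∈ S E, (𝓕 W : 𝓢(E, ℂ)) x = b x * (𝓕 u : 𝓢(E, ℂ)) (ψ x)) →
      Q (fun x => w k x * ‖W x‖) ≤ C * Q (fun x => w k x * ‖u x‖) := by
  obtain ⟨C0, hC0, H0⟩ := key volume h 0 (by omega) M
  obtain ⟨C1, hC1, H1⟩ := key volume h k hk M
  obtain ⟨D1, hD1⟩ := F1 (E := E) k
  obtain ⟨D2, hD2⟩ := F2 (E := E) k
  refine ⟨ENNReal.ofReal (2 * (2 ^ k) ^ 2) * (C0 + ENNReal.ofReal D1 * (C1 * ENNReal.ofReal D2)),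
    by finiteness, fun b hb hM u W hW => ?_⟩
  refine (Q_w_le k W).trans ?_
  rw [mul_assoc, add_mul]
  gcongr
  · rw [← Q_fourier]
    have := H0 b hb (fun x hx => by
      refine le_trans ?_ (hM x hx)
      simpa [NN] using le_NN (Nat.zero_le k) b x) _ _ hW
    simp only [norm_iteratedFDeriv_zero] at this
    refine this.trans ?_
    change C0 * Q (fun x => ‖(𝓕 u : 𝓢(E, ℂ)) x‖) ≤ _
    rw [Q_fourier]
    gcongr
    exact Q_mono fun x => le_mul_of_one_le_left (norm_nonneg _) (one_le_w k x)
  · refine (hD1 W).trans ?_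
    rw [mul_assoc, mul_assoc]
    gcongr
    refine (H1 b hb hM _ _ hW).trans ?_
    gcongr
    refine (hD2 u).trans ?_
    gcongr
    exact Q_mono fun x => mul_le_mul_of_nonneg_right (pow_le_w k x) (norm_nonneg _)

lemma keym {ψ φ : E → E} (h : Hom ψ φ) (k : ℕ)
    (hk : 2 * k < finrank ℝ E) (M : ℝ) :
    ∃ C : ℝ≥0∞, C ≠ ⊤ ∧ ∀ b : E → ℂ, ContDiffOn ℝ (⊤ : ℕ∞) b (S E) → (∀ x ∈ S E, NN k b x ≤ M) →
      (∃ r R : ℝ, 0 < r ∧ ∀ x, b x ≠ 0 → r ≤ ‖x‖ ∧ ‖x‖ ≤ R) →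
      (∀ x, (starRingEnd ℂ) (b x) = b x) →
      ∀ u W : 𝓢(E, ℂ), (∀ x ∈ S E, (𝓕 W : 𝓢(E, ℂ)) x = b x * (𝓕 u : 𝓢(E, ℂ)) (ψ x)) →
      Q (fun x => w (-k) x * ‖W x‖) ≤ C * Q (fun x => w (-k) x * ‖u x‖) := by
  have hJc : ContDiffOn ℝ (⊤ : ℕ∞) (fun y => (Jac φ y : ℂ)) (S E) :=
    Complex.ofRealCLM.contDiff.comp_contDiffOn h.symm.jac_cd
  obtain ⟨CJ, hCJ1, hCJ⟩ := NN_homog k 0 (fun y => (Jac φ y : ℂ)) hJc (by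
    intro a ha x hx
    simp [h.symm.jac_hom a ha x hx])
  obtain ⟨c, hc1, hc⟩ := h.symm.lower
  obtain ⟨c', hc1', hc'⟩ := h.symm.bound
  obtain ⟨C₁, hC₁0, hC₁⟩ := NN_comp (F := ℂ) k φ h.cdi h.nei h.homi c hc
  obtain ⟨C, hC, H⟩ := keyp h.symm k hk (2 ^ (2 * k + 1) * (CJ * (C₁ * M)))
  refine ⟨C, hC, fun b hb hM ⟨r, R, hr, hrR⟩ hreal u W hW => ?_⟩
  have hg : Function.HasTemperateGrowth (fun x : E => (1 + ‖x‖ ^ 2) ^ (-(k : ℝ))) :=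
    Function.hasTemperateGrowth_one_add_norm_sq_rpow E _
  set φ0 : 𝓢(E, ℂ) := smulLeftCLM ℂ (fun x : E => (1 + ‖x‖ ^ 2) ^ (-(k : ℝ))) W with hφ0
  have hφ : ∀ x, φ0 x = (w (-k) x * w (-k) x : ℝ) * W x := by
    intro x
    rw [hφ0, smulLeftCLM_apply_apply hg, w_mul, w]
    simp only [Complex.real_smul]
    congr 3
    ring
  have hbφ : ContDiffOn ℝ (⊤ : ℕ∞) (fun y => b (φ y)) (S E) := hb.comp h.cdi h.nei
  set b' : E → ℂ := (S E).indicator (fun y => (Jac φ y : ℂ) * b (φ y)) with hb'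
  have hb'S : ∀ y ∈ S E, b' y = (Jac φ y : ℂ) * b (φ y) := fun y hy => Set.indicator_of_mem hy _
  have hb'c : ContDiffOn ℝ (⊤ : ℕ∞) b' (S E) := (hJc.mul hbφ).congr hb'S
  have hb'M : ∀ y ∈ S E, NN k b' y ≤ 2 ^ (2 * k + 1) * (CJ * (C₁ * M)) := by
    intro y hy
    rw [NN_congr (g := fun y => (Jac φ y : ℂ) * b (φ y)) hb'S hy]
    refine (NN_mul k _ _ hJc hbφ hy).trans ?_
    gcongr
    · exact NN_nonneg _ _ _
    · simpa using hCJ y hy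
    · exact (hC₁ b hb y hy).trans (by gcongr; exact hM _ (h.nei y hy))
  have hann : ∀ y, b' y ≠ 0 → r / c' ≤ ‖y‖ ∧ ‖y‖ ≤ c * R := by
    intro y hy
    have hyS : y ∈ S E := by
      by_contra h0
      exact hy (Set.indicator_of_notMem h0 _)
    rw [hb'S y hyS] at hy
    obtain ⟨h1, h2⟩ := hrR _ (right_ne_zero_of_mul hy)
    constructor
    · rw [div_le_iff₀ (by positivity)]
      have := hc' y hyS
      linarith
    · refine (hc y hyS).trans ?_
      gcongr
  have hF : ContDiffOn ℝ (⊤ : ℕ∞) (fun y => (𝓕 φ0 : 𝓢(E, ℂ)) (φ y)) (S E) :=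
    ((𝓕 φ0 : 𝓢(E, ℂ)).smooth ⊤).comp_contDiffOn h.cdi
  obtain ⟨G, hG⟩ := mk hb'c hF (r := r / c') (R := c * R) (by positivity) hann
  set V : 𝓢(E, ℂ) := 𝓕⁻ G with hV
  have hVG : (𝓕 V : 𝓢(E, ℂ)) = G := by rw [hV]; exact FourierTransform.fourier_fourierInv_eq G
  have hVk := H b' hb'c hb'M φ0 V (fun x _ => by rw [hVG, hG])
  have hQφ : Q (fun x => w k x * ‖φ0 x‖) = Q (fun x => w (-k) x * ‖W x‖) := by
    congr 1
    ext x
    have h1 := w_pos (-k) x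
    have h2 : w k x * w (-k) x = 1 := by rw [w_mul, add_neg_cancel, w_zero]
    rw [hφ, norm_mul, Complex.norm_real, Real.norm_of_nonneg (by positivity), ← mul_assoc,
      ← mul_assoc, h2, one_mul]
  rw [hQφ] at hVk
  set A := Q (fun x => w (-k) x * ‖W x‖) with hA
  have hwle : ∀ x : E, w (-k) x ≤ 1 := by
    intro x
    have h1 := w_pos (-k) x
    have h2 : w k x * w (-k) x = 1 := by rw [w_mul, add_neg_cancel, w_zero]
    have h3 := one_le_w k x
    nlinarith
  have hAtop : A ≠ ⊤ := by
    have h1 : A ≤ Q (fun x => ‖W x‖) :=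
      Q_mono fun x => mul_le_of_le_one_left (norm_nonneg _) (hwle x)
    rw [Q_eq] at h1
    exact ne_top_of_le_ne_top ENNReal.ofReal_ne_top h1
  have hint : ∫ x, inner ℂ (W x) (φ0 x) = ∫ x, inner ℂ (u x) (V x) := by
    rw [← integral_inner_fourier_fourier W, ← integral_inner_fourier_fourier u, h.cov_int, hVG]
    refine integral_congr_ae ?_
    filter_upwards [ae_S volume] with y hy
    rw [hW _ (h.nei y hy), h.right y hy, hG, hb'S y hy]
    simp only [RCLike.inner_apply, map_mul, hreal, Complex.real_smul]
    ring
  have hAint : A = ‖∫ x, inner ℂ (W x) (φ0 x)‖ₑ := by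
    have h1 : ∀ x, inner ℂ (W x) (φ0 x) = (((w (-k) x * ‖W x‖) ^ 2 : ℝ) : ℂ) := by
      intro x
      rw [RCLike.inner_apply, hφ, mul_assoc, Complex.mul_conj, Complex.normSq_eq_norm_sq]
      push_cast; ring
    simp_rw [h1]
    rw [integral_complex_ofReal]
    have h0 : 0 ≤ ∫ x, (w (-k) x * ‖W x‖) ^ 2 := integral_nonneg fun x => by positivity
    rw [← ofReal_norm, Complex.norm_real, Real.norm_of_nonneg h0, hA, Q,
      ofReal_integral_eq_lintegral_ofReal]
    · refine lintegral_congr fun x => ?_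
      have h1 := w_pos (-k) x
      rw [ENNReal.ofReal_pow (by positivity)]
    · have h2 := (W.memLp 2 (volume : Measure E)).integrable_norm_pow (by norm_num)
      have h2 : Integrable (fun x => ‖W x‖ ^ 2) := by simpa using h2
      refine Integrable.mono' h2 ?_ ?_
      · have := W.continuous
        have hw := w_continuous (E := E) (-k)
        fun_prop
      · refine Filter.Eventually.of_forall fun x => ?_
        have h1 := w_pos (-k) x
        rw [Real.norm_of_nonneg (by positivity)]
        have : w (-k) x * ‖W x‖ ≤ ‖W x‖ := mul_le_of_le_one_left (norm_nonneg _) (hwle x)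
        gcongr
    · exact Filter.Eventually.of_forall fun x => by positivity
  have hA2 : A ^ 2 ≤ Q (fun x => w (-k) x * ‖u x‖) * Q (fun x => w k x * ‖V x‖) := by
    have h1 : A ≤ ∫⁻ x, ENNReal.ofReal (w (-k) x * ‖u x‖) * ENNReal.ofReal (w k x * ‖V x‖) := by
      rw [hAint, hint]
      refine (enorm_integral_le_lintegral_enorm _).trans (lintegral_mono fun x => ?_)
      have h1 := w_pos (-k) x
      have h2 : w k x * w (-k) x = 1 := by rw [w_mul, add_neg_cancel, w_zero]
      rw [← ENNReal.ofReal_mul (by positivity), ← ofReal_norm]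
      apply ENNReal.ofReal_le_ofReal
      refine (norm_inner_le_norm _ _).trans (le_of_eq ?_)
      calc _ = (w k x * w (-k) x) * (‖u x‖ * ‖V x‖) := by rw [h2, one_mul]
        _ = _ := by ring
    refine (pow_le_pow_left' h1 2).trans ?_
    have hw := w_continuous (E := E) (-k)
    have hw' := w_continuous (E := E) k
    have := u.continuous
    have := V.continuous
    exact cs_lintegral _ (by fun_prop) (by fun_prop)
  have hfin : A * A ≤ C * Q (fun x => w (-k) x * ‖u x‖) * A := by
    calc A * A = A ^ 2 := (sq A).symm
      _ ≤ _ := hA2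
      _ ≤ Q (fun x => w (-k) x * ‖u x‖) * (C * A) := by gcongr
      _ = _ := by ring
  rcases eq_or_ne A 0 with h0 | h0
  · rw [h0]; exact zero_le
  · exact (ENNReal.mul_le_mul_iff_left h0 hAtop).1 hfin

end four
end PW

namespace PW
open Module LineDeriv FourierTransform

section fin
variable {E : Type*} [NormedAddCommGroup E] [InnerProductSpace ℝ E] [FiniteDimensional ℝ E]
  [MeasurableSpace E] [BorelSpace E] [Nontrivial E]

lemma keyz {ψ φ : E → E} (h : Hom ψ φ) (m : ℤ)
    (hk : 2 * m.natAbs < finrank ℝ E) (M : ℝ) :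
    ∃ C : ℝ≥0∞, C ≠ ⊤ ∧ ∀ b : E → ℂ, ContDiffOn ℝ (⊤ : ℕ∞) b (S E) →
      (∀ x ∈ S E, NN m.natAbs b x ≤ M) →
      (∃ r R : ℝ, 0 < r ∧ ∀ x, b x ≠ 0 → r ≤ ‖x‖ ∧ ‖x‖ ≤ R) →
      (∀ x, (starRingEnd ℂ) (b x) = b x) →
      ∀ u W : 𝓢(E, ℂ), (∀ x ∈ S E, (𝓕 W : 𝓢(E, ℂ)) x = b x * (𝓕 u : 𝓢(E, ℂ)) (ψ x)) →
      Q (fun x => w m x * ‖W x‖) ≤ C * Q (fun x => w m x * ‖u x‖) := by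
  obtain ⟨k, rfl | rfl⟩ := m.eq_nat_or_neg
  · obtain ⟨C, hC, H⟩ := keyp h k (by simpa using hk) M
    refine ⟨C, hC, fun b hb hM _ _ u W hW => ?_⟩
    simpa using H b hb (by simpa using hM) u W hW
  · obtain ⟨C, hC, H⟩ := keym h k (by simpa using hk) M
    refine ⟨C, hC, fun b hb hM h1 h2 u W hW => ?_⟩
    simpa using H b hb (by simpa using hM) h1 h2 u W hW

lemma NN_sub (k : ℕ) (f g : E → ℂ) (hf : ContDiffOn ℝ (⊤ : ℕ∞) f (S E))
    (hg : ContDiffOn ℝ (⊤ : ℕ∞) g (S E)) {x : E} (hx : x ∈ S E) :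
    NN k (fun z => f z - g z) x ≤ NN k f x + NN k g x := by
  unfold NN
  rw [← Finset.sum_add_distrib]
  refine Finset.sum_le_sum fun j _ => ?_
  have : (fun z => f z - g z) = f - g := rfl
  rw [this, iteratedFDerivWithin_sub_apply ((hf x hx).of_le (mod_cast le_top))
    ((hg x hx).of_le (mod_cast le_top)) udS hx, ← mul_add]
  gcongr
  exact norm_sub_le _ _

lemma cutoffs (k : ℕ) : ∃ M : ℝ, ∃ κ : ℕ → E → ℂ, ∀ j,
    ContDiff ℝ (⊤ : ℕ∞) (κ j) ∧ (∀ x ∈ S E, NN k (κ j) x ≤ M) ∧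
    (∃ r R : ℝ, 0 < r ∧ ∀ x, κ j x ≠ 0 → r ≤ ‖x‖ ∧ ‖x‖ ≤ R) ∧
    (∀ x, (starRingEnd ℂ) (κ j x) = κ j x) ∧ (∀ x, ‖κ j x‖ ≤ 1) ∧
    ∀ x ∈ S E, 2 ≤ (j + 1) * ‖x‖ → ‖x‖ ≤ j + 1 → κ j x = 1 := by
  let θ : ContDiffBump (0 : E) := ⟨1, 2, by norm_num, by norm_num⟩
  have hin : ∀ x : E, ‖x‖ ≤ 1 → θ x = 1 := fun x hx =>
    θ.one_of_mem_closedBall (by simpa [θ] using hx)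
  have hout : ∀ x : E, 2 ≤ ‖x‖ → θ x = 0 := fun x hx =>
    θ.zero_of_le_dist (by simpa [θ] using hx)
  let t : E → ℂ := fun x => (θ x : ℂ)
  have ht : ContDiff ℝ (⊤ : ℕ∞) t := Complex.ofRealCLM.contDiff.comp θ.contDiff
  have htc : HasCompactSupport t := θ.hasCompactSupport.comp_left (g := fun r : ℝ => (r : ℂ)) (by simp)
  let T : 𝓢(E, ℂ) := htc.toSchwartzMap ht
  have hT : ∀ x, T x = t x := fun x => rfl
  choose D hD0 hD using fun j => T.decay j j
  have hM : ∀ x ∈ S E, NN k t x ≤ ∑ j ∈ Finset.range (k + 1), D j := by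
    intro x hx
    unfold NN
    refine Finset.sum_le_sum fun j _ => ?_
    rw [iteratedFDerivWithin_of_isOpen j isOpenS hx]
    exact hD j x
  refine ⟨2 * ∑ j ∈ Finset.range (k + 1), D j,
    fun j x => t (((j : ℝ) + 1)⁻¹ • x) - t (((j : ℝ) + 1) • x), fun j => ?_⟩
  have ha : (0 : ℝ) < (j : ℝ) + 1 := by positivity
  have ha1 : (1 : ℝ) ≤ (j : ℝ) + 1 := by linarith [Nat.cast_nonneg (α := ℝ) j]
  set a : ℝ := (j : ℝ) + 1
  have n1 : ∀ x : E, ‖a⁻¹ • x‖ = ‖x‖ / a := fun x => by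
    rw [norm_smul, Real.norm_of_nonneg (by positivity)]; field_simp
  have n2 : ∀ x : E, ‖a • x‖ = a * ‖x‖ := fun x => by
    rw [norm_smul, Real.norm_of_nonneg (by positivity)]
  have c1 : ∀ c : ℝ, ContDiff ℝ (⊤ : ℕ∞) (fun x : E => t (c • x)) := fun c =>
    ht.comp (contDiff_const_smul c)
  have hS : ∀ c : ℝ, 0 < c → ∀ x ∈ S E, c • x ∈ S E := by
    intro c hc x hx
    have : x ≠ 0 := hx
    simp [hc.ne', this]
  refine ⟨(c1 _).sub (c1 _), fun x hx => ?_, ⟨1 / a, 2 * a, by positivity, fun x hx => ?_⟩,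
    fun x => ?_, fun x => ?_, fun x hx h2 h1 => ?_⟩
  · refine (NN_sub k _ _ (c1 _).contDiffOn (c1 _).contDiffOn hx).trans ?_
    rw [NN_scale k t (by positivity) hx, NN_scale k t ha hx, two_mul]
    exact add_le_add (hM _ (hS _ (by positivity) x hx)) (hM _ (hS _ ha x hx))
  · constructor
    · by_contra! hlt
      apply hx
      rw [lt_div_iff₀ ha] at hlt
      have e1 : θ (a⁻¹ • x) = 1 := hin _ (by
        rw [n1, div_le_one ha]; nlinarith [norm_nonneg x])
      have e2 : θ (a • x) = 1 := hin _ (by rw [n2]; linarith)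
      change ((θ (a⁻¹ • x) : ℝ) : ℂ) - ((θ (a • x) : ℝ) : ℂ) = 0
      rw [e1, e2]; simp
    · by_contra! hlt
      apply hx
      have e1 : θ (a⁻¹ • x) = 0 := hout _ (by
        rw [n1, le_div_iff₀ ha]; linarith)
      have e2 : θ (a • x) = 0 := hout _ (by rw [n2]; nlinarith)
      change ((θ (a⁻¹ • x) : ℝ) : ℂ) - ((θ (a • x) : ℝ) : ℂ) = 0
      rw [e1, e2]; simp
  · simp [t]
  · simp only [t]
    rw [← Complex.ofReal_sub, Complex.norm_real, Real.norm_eq_abs, abs_le]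
    have := θ.nonneg (x := a⁻¹ • x)
    have := θ.nonneg (x := a • x)
    have := θ.le_one (x := a⁻¹ • x)
    have := θ.le_one (x := a • x)
    constructor <;> linarith
  · have e1 : θ (a⁻¹ • x) = 1 := hin _ (by rw [n1, div_le_one ha]; exact h1)
    have e2 : θ (a • x) = 0 := hout _ (by rw [n2]; exact h2)
    change ((θ (a⁻¹ • x) : ℝ) : ℂ) - ((θ (a • x) : ℝ) : ℂ) = 1
    rw [e1, e2]; simp

lemma main {ψ φ : E → E} (h : Hom ψ φ) (m : ℤ) (hk : 2 * m.natAbs < finrank ℝ E) :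
    ∃ C : ℝ≥0∞, C ≠ ⊤ ∧ ∀ u : 𝓢(E, ℂ),
      Q (fun x => w m x * ‖𝓕⁻ (fun ξ => 𝓕 (⇑u) (ψ ξ)) x‖) ≤ C * Q (fun x => w m x * ‖u x‖) := by
  obtain ⟨M, κ, hκ⟩ := cutoffs (E := E) m.natAbs
  obtain ⟨C, hC, H⟩ := keyz h m hk M
  obtain ⟨CJ, hCJ⟩ := h.cov_le (volume : Measure E)
  refine ⟨C, hC, fun u => ?_⟩
  set F : E → ℂ := fun ξ => (𝓕 u : 𝓢(E, ℂ)) (ψ ξ) with hF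
  have hF' : (fun ξ => 𝓕 (⇑u) (ψ ξ)) = F := by
    ext ξ; rw [hF, fourier_coe]
  rw [hF']
  have hFc : ContDiffOn ℝ (⊤ : ℕ∞) F (S E) := ((𝓕 u : 𝓢(E, ℂ)).smooth ⊤).comp_contDiffOn h.cd
  have hFm : AEStronglyMeasurable F volume := by
    rw [← restrictS (volume : Measure E)]
    exact hFc.continuousOn.aestronglyMeasurable isOpenS.measurableSet
  have hFi : Integrable F := by
    refine ⟨hFm, ?_⟩
    have h1 := hCJ (fun y => ‖(𝓕 u : 𝓢(E, ℂ)) y‖ₑ)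
    have h2 : ∫⁻ y, ‖(𝓕 u : 𝓢(E, ℂ)) y‖ₑ ≠ ⊤ := (𝓕 u : 𝓢(E, ℂ)).integrable.2.ne
    exact h1.trans_lt (by finiteness)
  have hex : ∀ j, ∃ G : 𝓢(E, ℂ), ∀ x, G x = κ j x * F x := by
    intro j
    obtain ⟨h1, h2, ⟨r, R, hr, h3⟩, h4, h5, h6⟩ := hκ j
    exact mk h1.contDiffOn hFc hr h3
  choose G hG using hex
  have hW : ∀ j, Q (fun x => w m x * ‖(𝓕⁻ (G j) : 𝓢(E, ℂ)) x‖) ≤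
      C * Q (fun x => w m x * ‖u x‖) := by
    intro j
    obtain ⟨h1, h2, h3, h4, h5, h6⟩ := hκ j
    refine H (κ j) h1.contDiffOn h2 h3 h4 u (𝓕⁻ (G j)) fun x _ => ?_
    rw [FourierTransform.fourier_fourierInv_eq, hG]
  have hlim : ∀ x, Filter.Tendsto (fun j => (𝓕⁻ (G j) : 𝓢(E, ℂ)) x) Filter.atTop
      (nhds (𝓕⁻ F x)) := by
    intro x
    simp_rw [fourierInv_coe, Real.fourierInv_eq]
    refine tendsto_integral_of_dominated_convergence (fun ξ => ‖F ξ‖) ?_ hFi.norm ?_ ?_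
    · intro j
      refine Continuous.aestronglyMeasurable ?_
      have := (G j).continuous
      have := Real.continuous_fourierChar
      fun_prop
    · intro j
      refine Filter.Eventually.of_forall fun ξ => ?_
      rw [Circle.norm_smul, hG, norm_mul]
      exact mul_le_of_le_one_left (norm_nonneg _) ((hκ j).2.2.2.2.1 ξ)
    · filter_upwards [ae_S volume] with ξ hξ
      refine tendsto_const_nhds.congr' ?_
      have hξ0 : 0 < ‖ξ‖ := norm_pos_iff.2 hξ
      obtain ⟨N, hN⟩ := exists_nat_ge (max (2 / ‖ξ‖) ‖ξ‖)
      filter_upwards [Filter.eventually_ge_atTop N] with j hj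
      have hj' : (N : ℝ) ≤ j := by exact_mod_cast hj
      have h1 : 2 / ‖ξ‖ ≤ j + 1 := by linarith [le_max_left (2 / ‖ξ‖) ‖ξ‖]
      have h2 : ‖ξ‖ ≤ j + 1 := by linarith [le_max_right (2 / ‖ξ‖) ‖ξ‖]
      rw [div_le_iff₀ hξ0] at h1
      rw [hG, (hκ j).2.2.2.2.2 ξ hξ h1 h2, one_mul]
  calc Q (fun x => w m x * ‖𝓕⁻ F x‖)
      = ∫⁻ x, Filter.liminf (fun j => ENNReal.ofReal (w m x * ‖(𝓕⁻ (G j) : 𝓢(E, ℂ)) x‖) ^ 2)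
        Filter.atTop := by
        refine lintegral_congr fun x => ?_
        refine (Filter.Tendsto.liminf_eq ?_).symm
        refine ENNReal.Tendsto.pow ?_
        refine ENNReal.tendsto_ofReal ?_
        exact (hlim x).norm.const_mul _
    _ ≤ Filter.liminf (fun j => Q (fun x => w m x * ‖(𝓕⁻ (G j) : 𝓢(E, ℂ)) x‖)) Filter.atTop := by
        refine lintegral_liminf_le' fun j => ?_
        have := (𝓕⁻ (G j) : 𝓢(E, ℂ)).continuous
        have := w_continuous (E := E) m
        fun_prop
    _ ≤ Filter.liminf (fun j : ℕ => C * Q (fun x => w m x * ‖u x‖)) Filter.atTop :=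
        Filter.liminf_le_liminf (Filter.Eventually.of_forall hW)
    _ = _ := by simp

end fin

section norm
variable {n : ℕ}

lemma FTint_eq (u : EuclideanSpace ℝ (Fin n) → ℂ) (ξ : EuclideanSpace ℝ (Fin n)) :
    FTint u ξ = 𝓕 u ((2 * π)⁻¹ • ξ) := by
  rw [FTint, Real.fourier_eq']
  refine integral_congr_ae (Filter.Eventually.of_forall fun x => ?_)
  simp only [inner_smul_right, smul_eq_mul]
  congr 2
  have : (π : ℂ) ≠ 0 := by exact_mod_cast Real.pi_ne_zero
  push_cast
  field_simp

lemma T_eq [Nontrivial (EuclideanSpace ℝ (Fin n))]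
    {ψ φ : EuclideanSpace ℝ (Fin n) → EuclideanSpace ℝ (Fin n)} (h : Hom ψ φ)
    (u : EuclideanSpace ℝ (Fin n) → ℂ) (x : EuclideanSpace ℝ (Fin n)) :
    FTinvInt (fun ξ => FTint u (ψ ξ)) x = 𝓕⁻ (fun ξ => 𝓕 u (ψ ξ)) x := by
  have hp : (0 : ℝ) < 2 * π := by positivity
  have h1 := Measure.integral_comp_smul (volume : Measure (EuclideanSpace ℝ (Fin n)))
    (fun ξ => Complex.exp (Complex.I * (⟪x, ξ⟫ : ℝ)) * FTint u (ψ ξ)) (2 * π)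
  rw [finrank_euclideanSpace_fin, abs_of_nonneg (by positivity), Complex.real_smul,
    Complex.ofReal_inv] at h1
  rw [FTinvInt, ← h1, Real.fourierInv_eq']
  refine integral_congr_ae ?_
  filter_upwards [ae_S volume] with ξ hξ
  rw [h.hom _ hp ξ hξ, FTint_eq, smul_smul, inv_mul_cancel₀ hp.ne', one_smul, smul_eq_mul,
    inner_smul_right, real_inner_comm]
  congr 2
  push_cast
  ring

lemma eLp_eq (m : ℤ) (f : EuclideanSpace ℝ (Fin n) → ℂ) :
    eLpNorm (fun x => ((jap x ^ (m : ℝ) : ℝ) : ℂ) * f x) 2 volume =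
      Q (fun x => w m x * ‖f x‖) ^ (1 / 2 : ℝ) := by
  rw [eLpNorm_eq_lintegral_rpow_enorm_toReal (by norm_num) (by norm_num), Q]
  simp only [ENNReal.toReal_ofNat]
  congr 1
  refine lintegral_congr fun x => ?_
  have h1 : jap x ^ (m : ℝ) = w m x := by
    rw [jap, w, Real.sqrt_eq_rpow, ← Real.rpow_mul (by positivity)]
    congr 1; ring
  rw [h1, ← ofReal_norm, norm_mul, Complex.norm_real, Real.norm_of_nonneg (w_pos _ _).le]
  norm_num

lemma final [Nontrivial (EuclideanSpace ℝ (Fin n))]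
    {ψ φ : EuclideanSpace ℝ (Fin n) → EuclideanSpace ℝ (Fin n)} (h : Hom ψ φ)
    (m : ℤ) (hm : 2 * m.natAbs < n) : ∃ C : ℝ, ∀ u : 𝓢(EuclideanSpace ℝ (Fin n), ℂ),
        eLpNorm (fun x => ((jap x ^ (m : ℝ) : ℝ) : ℂ) *
            FTinvInt (fun ξ => FTint (⇑u) (ψ ξ)) x) 2 volume
          ≤ ENNReal.ofReal C *
            eLpNorm (fun x => ((jap x ^ (m : ℝ) : ℝ) : ℂ) * u x) 2 volume := by
  obtain ⟨C, hC, H⟩ := main h m (by simpa using hm)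
  refine ⟨(C ^ (1 / 2 : ℝ)).toReal, fun u => ?_⟩
  rw [ENNReal.ofReal_toReal (by finiteness), eLp_eq, eLp_eq, ← ENNReal.mul_rpow_of_nonneg _ _ (by norm_num)]
  simp_rw [T_eq h]
  exact ENNReal.rpow_le_rpow (H u) (by norm_num)

end norm
end PW

/-- (Corollary 4.1.) For a smooth positively homogeneous (of degree 1)
bijection `ψ` of `ℝ^n∖{0}` with smooth inverse and `|det Dψ| ≥ C₀ > 0`, the operators
`T_ψ u = F⁻¹[(Fu)∘ψ]` and `T_ψ⁻¹ u = F⁻¹[(Fu)∘ψ⁻¹]` are bounded on `L²_m(ℝ^n)` for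
every integer `m` with `|m| < n/2`. -/
theorem statement15 (n : ℕ)
    (ψ ψinv : EuclideanSpace ℝ (Fin n) → EuclideanSpace ℝ (Fin n))
    (hψ : ContDiffOn ℝ (⊤ : ℕ∞) ψ {0}ᶜ) (hψinv : ContDiffOn ℝ (⊤ : ℕ∞) ψinv {0}ᶜ)
    (hψ0 : ∀ ξ, ξ ≠ 0 → ψ ξ ≠ 0) (hψinv0 : ∀ ξ, ξ ≠ 0 → ψinv ξ ≠ 0)
    (hleft : ∀ ξ, ξ ≠ 0 → ψinv (ψ ξ) = ξ) (hright : ∀ ξ, ξ ≠ 0 → ψ (ψinv ξ) = ξ)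
    (hhom : ∀ lam : ℝ, 0 < lam → ∀ ξ, ξ ≠ 0 → ψ (lam • ξ) = lam • ψ ξ)
    (hhominv : ∀ lam : ℝ, 0 < lam → ∀ ξ, ξ ≠ 0 → ψinv (lam • ξ) = lam • ψinv ξ)
    (C₀ : ℝ) (hC₀ : 0 < C₀) (hdet : ∀ ξ, ξ ≠ 0 → C₀ ≤ |Matrix.det (jacMat ψ ξ)|)
    (m : ℤ) (hm : 2 * m.natAbs < n) :
    ∃ C : ℝ,
      ∀ u : 𝓢(EuclideanSpace ℝ (Fin n), ℂ),
        eLpNorm (fun x => ((jap x ^ (m : ℝ) : ℝ) : ℂ) *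
            FTinvInt (fun ξ => FTint (⇑u) (ψ ξ)) x) 2 volume
          ≤ ENNReal.ofReal C *
            eLpNorm (fun x => ((jap x ^ (m : ℝ) : ℝ) : ℂ) * u x) 2 volume ∧
        eLpNorm (fun x => ((jap x ^ (m : ℝ) : ℝ) : ℂ) *
            FTinvInt (fun ξ => FTint (⇑u) (ψinv ξ)) x) 2 volume
          ≤ ENNReal.ofReal C *
            eLpNorm (fun x => ((jap x ^ (m : ℝ) : ℝ) : ℂ) * u x) 2 volume := by
  have hN : Nontrivial (EuclideanSpace ℝ (Fin n)) := by
    have : Nonempty (Fin n) := ⟨⟨0, by omega⟩⟩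
    infer_instance
  have h : PW.Hom ψ ψinv := ⟨hψ, hψinv, hψ0, hψinv0, hleft, hright, hhom, hhominv⟩
  obtain ⟨C1, H1⟩ := PW.final h m hm
  obtain ⟨C2, H2⟩ := PW.final h.symm m hm
  refine ⟨max C1 C2, fun u => ⟨(H1 u).trans ?_, (H2 u).trans ?_⟩⟩
  · gcongr
    exact le_max_left _ _
  · gcongr
    exact le_max_right _ _
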